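/- arXiv:1507.07672 — 9 statements merged into one kernel-verified Lean document; each statement's English description precedes it below -/
import Mathlib

section
/- There is an absolute constant c > 0 such that for every finite set A of real numbers with |A| ≥ 2, the quotient set of sums satisfies |(A+A)/(A+A)| ≥ c · |A|^(52/25) / (|A:A|^(1/25) · log₂|A|). -/
open scoped Classical

/-- The quotient set of sums `(A+A)/(A+A) = {(a+b)/(c+d) : a,b,c,d ∈ A, c+d ≠ 0}`. -/
noncomputable def quotSumSet (A : Finset ℝ) : Finset ℝ :=
  (((A ×ˢ A) ×ˢ (A ×ˢ A)).filter fun p => p.2.1 + p.2.2 ≠ 0).image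
    fun p => (p.1.1 + p.1.2) / (p.2.1 + p.2.2)

/-- The ratio set `A:A = {a/b : a,b ∈ A, b ≠ 0}`. -/
noncomputable def ratioSet (A : Finset ℝ) : Finset ℝ :=
  ((A ×ˢ A).filter fun p => p.2 ≠ 0).image fun p => p.1 / p.2


namespace QuotSum

open Finset

/-- The number of elements of `S` below `x`. -/
noncomputable def rank (S : Finset ℝ) (x : ℝ) : ℕ := #{y ∈ S | y < x}

lemma rank_mono (S : Finset ℝ) : Monotone (rank S) := fun _ _ h =>
  card_le_card (monotone_filter_right S fun _ _ hy => lt_of_lt_of_le hy h)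

lemma rank_lt_rank {S : Finset ℝ} {x y : ℝ} (hx : x ∈ S) (h : x < y) : rank S x < rank S y := by
  refine card_lt_card ⟨monotone_filter_right S fun _ _ hy => lt_trans hy h, fun hs => ?_⟩
  have := hs (mem_filter.2 ⟨hx, h⟩)
  simp at this

lemma rank_lt_card {S : Finset ℝ} {x : ℝ} (hx : x ∈ S) : rank S x < #S := by
  refine card_lt_card ⟨filter_subset _ _, fun hs => ?_⟩
  have := hs hx
  simp at this

lemma rank_injOn (S : Finset ℝ) : Set.InjOn (rank S) S := by
  intro x hx y hy h
  rcases lt_trichotomy x y with hxy | hxy | hxy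
  · exact absurd h (rank_lt_rank hx hxy).ne
  · exact hxy
  · exact absurd h (rank_lt_rank hy hxy).ne'

lemma image_rank (S : Finset ℝ) : S.image (rank S) = range #S := by
  refine eq_of_subset_of_card_le (fun i hi => ?_) ?_
  · obtain ⟨x, hx, rfl⟩ := mem_image.1 hi
    exact mem_range.2 (rank_lt_card hx)
  · rw [card_image_of_injOn (rank_injOn S), card_range]

lemma card_filter_rank_mem {S : Finset ℝ} {T : Finset ℕ} (hT : T ⊆ range #S) :
    #{x ∈ S | rank S x ∈ T} = #T := by
  rw [← card_image_of_injOn ((rank_injOn S).mono (filter_subset _ _))]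
  congr 1
  ext i
  simp only [mem_image, mem_filter]
  constructor
  · rintro ⟨x, ⟨-, hx⟩, rfl⟩
    exact hx
  · intro hi
    have := hT hi
    rw [← image_rank] at this
    obtain ⟨x, hx, rfl⟩ := mem_image.1 this
    exact ⟨x, ⟨hx, hi⟩, rfl⟩

lemma card_filter_rank_div_le (S : Finset ℝ) {D : ℕ} (hD : 0 < D) (j : ℕ) :
    #{x ∈ S | rank S x / D = j} ≤ D := by
  have : #{x ∈ S | rank S x / D = j} ≤ #(Ico (j * D) (j * D + D)) := by
    refine card_le_card_of_injOn (rank S) (fun x hx => ?_)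
      ((rank_injOn S).mono (filter_subset _ _))
    have hx := (mem_filter.1 hx).2
    rw [Nat.div_eq_iff hD] at hx
    simp only [coe_Ico, Set.mem_Ico]
    omega
  simpa using this

/-- A curve is the set of solutions of `R l`. If the curves are increasing, any two grid points
lie on at most `k` of them, and the grid is cut into cells of side `D`, then there are few
incidences. -/
lemma card_incidences_le {ι : Type*} (L : Finset ι) (B B' : Finset ℝ) (R : ι → ℝ → ℝ → Prop)
    {D k t : ℕ} (hD : 0 < D) (hB : #B = t) (hB' : #B' = t)
    (hmono : ∀ l ∈ L, ∀ u ∈ B, ∀ u₁ ∈ B, ∀ v ∈ B', ∀ v₁ ∈ B',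
      R l u v → R l u₁ v₁ → (u < u₁ ↔ v < v₁))
    (hpair : ∀ u ∈ B, ∀ u₁ ∈ B, ∀ v ∈ B', ∀ v₁ ∈ B', u < u₁ → v < v₁ →
      #{l ∈ L | R l u v ∧ R l u₁ v₁} ≤ k) :
    #{x ∈ L ×ˢ (B ×ˢ B') | R x.1 x.2.1 x.2.2} ≤
      #L * (2 * (t / D) + 1) + k * (t ^ 2 * D ^ 2) := by
  set G := B ×ˢ B' with hG
  set cell : ℝ × ℝ → ℕ × ℕ := fun p => (rank B p.1 / D, rank B' p.2 / D) with hcell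
  set pairs := {w ∈ G ×ˢ G | w.1.1 < w.2.1 ∧ w.1.2 < w.2.2 ∧ cell w.2 = cell w.1} with hpairs
  have hcurve : ∀ l ∈ L, #{p ∈ G | R l p.1 p.2} ≤
      (2 * (t / D) + 1) + #{w ∈ pairs | R l w.1.1 w.1.2 ∧ R l w.2.1 w.2.2} := by
    intro l hl
    set P := {p ∈ G | R l p.1 p.2} with hP
    have hPmem : ∀ p, p ∈ P ↔ p.1 ∈ B ∧ p.2 ∈ B' ∧ R l p.1 p.2 := by
      intro p; simp [hP, hG, and_assoc]
    rw [← card_filter_add_card_filter_not (s := P)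
      (p := fun p => ∃ q ∈ P, q.1 < p.1 ∧ cell p = cell q), add_comm]
    refine add_le_add ?_ ?_
    · rw [← card_range (2 * (t / D) + 1)]
      refine card_le_card_of_injOn (fun p => (cell p).1 + (cell p).2) ?_ ?_
      · intro p hp
        have hp := (hPmem p).1 (mem_filter.1 hp).1
        have h1 := (rank_lt_card hp.1).le
        have h2 := (rank_lt_card hp.2.1).le
        rw [hB] at h1
        rw [hB'] at h2
        have h1 := Nat.div_le_div_right (c := D) h1
        have h2 := Nat.div_le_div_right (c := D) h2
        simp only [coe_range, Set.mem_Iio, hcell]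
        omega
      · have key : ∀ p ∈ P, ∀ q ∈ P, (cell p).1 + (cell p).2 = (cell q).1 + (cell q).2 →
            q.1 < p.1 → cell p = cell q := by
          intro p hp q hq h hlt
          have hp := (hPmem p).1 hp
          have hq := (hPmem q).1 hq
          have hlt' := (hmono l hl _ hq.1 _ hp.1 _ hq.2.1 _ hp.2.1 hq.2.2 hp.2.2).1 hlt
          have h1 := Nat.div_le_div_right (c := D) (rank_mono B hlt.le)
          have h2 := Nat.div_le_div_right (c := D) (rank_mono B' hlt'.le)
          simp only [hcell] at h ⊢
          ext <;> simp only <;> omega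
        intro p hp q hq h
        have hp := mem_filter.1 hp
        have hq := mem_filter.1 hq
        rcases lt_trichotomy p.1 q.1 with hlt | heq | hlt
        · exact absurd ⟨p, hp.1, hlt, key q hq.1 p hp.1 h.symm hlt⟩ hq.2
        · have hp' := (hPmem p).1 hp.1
          have hq' := (hPmem q).1 hq.1
          have h1 := hmono l hl _ hq'.1 _ hp'.1 _ hq'.2.1 _ hp'.2.1 hq'.2.2 hp'.2.2
          have h2 := hmono l hl _ hp'.1 _ hq'.1 _ hp'.2.1 _ hq'.2.1 hp'.2.2 hq'.2.2
          refine Prod.ext heq ?_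
          have h3 := not_lt.1 (fun h => h1.not.1 (by simp [heq]) h)
          have h4 := not_lt.1 (fun h => h2.not.1 (by simp [heq]) h)
          exact le_antisymm h3 h4
        · exact absurd ⟨q, hq.1, hlt, key p hp.1 q hq.1 h hlt⟩ hp.2
    · have : ∀ p : ℝ × ℝ, ∃ q : ℝ × ℝ,
          p ∈ {p ∈ P | ∃ q ∈ P, q.1 < p.1 ∧ cell p = cell q} →
            q ∈ P ∧ q.1 < p.1 ∧ cell p = cell q := by
        intro p
        by_cases hp : p ∈ {p ∈ P | ∃ q ∈ P, q.1 < p.1 ∧ cell p = cell q}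
        · obtain ⟨q, hq⟩ := (mem_filter.1 hp).2
          exact ⟨q, fun _ => hq⟩
        · exact ⟨p, fun h => absurd h hp⟩
      choose f hf using this
      refine card_le_card_of_injOn (fun p => (f p, p)) ?_ ?_
      · intro p hp
        have hfp := hf p hp
        have hq := (hPmem _).1 hfp.1
        have hp := (hPmem p).1 (mem_filter.1 hp).1
        have hlt := (hmono l hl _ hq.1 _ hp.1 _ hq.2.1 _ hp.2.1 hq.2.2 hp.2.2).1 hfp.2.1
        simp only [hpairs, hG, coe_filter, mem_filter, mem_product, Set.mem_ofPred_eq]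
        exact ⟨⟨⟨⟨hq.1, hq.2.1⟩, hp.1, hp.2.1⟩, hfp.2.1, hlt, hfp.2.2⟩, hq.2.2, hp.2.2⟩
      · intro p _ q _ h
        exact (Prod.ext_iff.1 h).2
  have hsum : #{x ∈ L ×ˢ G | R x.1 x.2.1 x.2.2} = ∑ l ∈ L, #{p ∈ G | R l p.1 p.2} := by
    simp only [card_filter, sum_product]
  have hswap : ∑ l ∈ L, #{w ∈ pairs | R l w.1.1 w.1.2 ∧ R l w.2.1 w.2.2} =
      ∑ w ∈ pairs, #{l ∈ L | R l w.1.1 w.1.2 ∧ R l w.2.1 w.2.2} := by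
    simp only [card_filter]
    exact sum_comm
  have hpairs_card : #pairs ≤ t ^ 2 * D ^ 2 := by
    calc #pairs ≤ #{w ∈ G ×ˢ G | cell w.2 = cell w.1} :=
          card_le_card (monotone_filter_right _ fun _ _ h => h.2.2)
      _ = ∑ p ∈ G, #{q ∈ G | cell q = cell p} := by simp only [card_filter, sum_product]
      _ ≤ ∑ p ∈ G, D ^ 2 := by
          refine sum_le_sum fun p _ => ?_
          calc #{q ∈ G | cell q = cell p}
              = #({x ∈ B | rank B x / D = (cell p).1} ×ˢ
                  {x ∈ B' | rank B' x / D = (cell p).2}) := by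
                congr 1
                ext q
                simp only [hG, hcell, mem_filter, mem_product, Prod.ext_iff]
                tauto
            _ ≤ D * D := by
                rw [card_product]
                exact Nat.mul_le_mul (card_filter_rank_div_le _ hD _)
                  (card_filter_rank_div_le _ hD _)
            _ = D ^ 2 := (sq D).symm
      _ = t ^ 2 * D ^ 2 := by
          rw [sum_const, hG, card_product, hB, hB', smul_eq_mul, sq t]
  calc #{x ∈ L ×ˢ G | R x.1 x.2.1 x.2.2}
      ≤ ∑ l ∈ L, ((2 * (t / D) + 1) + #{w ∈ pairs | R l w.1.1 w.1.2 ∧ R l w.2.1 w.2.2}) := by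
        rw [hsum]; exact sum_le_sum hcurve
    _ = #L * (2 * (t / D) + 1) +
        ∑ w ∈ pairs, #{l ∈ L | R l w.1.1 w.1.2 ∧ R l w.2.1 w.2.2} := by
        rw [sum_add_distrib, hswap, sum_const, smul_eq_mul]
    _ ≤ #L * (2 * (t / D) + 1) + ∑ w ∈ pairs, k := by
        gcongr with w hw
        simp only [hpairs, hG, mem_filter, mem_product] at hw
        exact hpair _ hw.1.1.1 _ hw.1.2.1 _ hw.1.1.2 _ hw.1.2.2 hw.2.1 hw.2.2.1
    _ ≤ #L * (2 * (t / D) + 1) + k * (t ^ 2 * D ^ 2) := by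
        rw [sum_const, smul_eq_mul, mul_comm k]
        gcongr

/-- The slope of the sum of the points of abscissae `u` and `c` on the lines through the origin
of slopes `l` and `m`. -/
noncomputable def sumSlope (l m u c : ℝ) : ℝ := (l * u + m * c) / (u + c)

lemma sumSlope_lt_right {l m u c : ℝ} (h : l < m) (hu : 0 < u) (hc : 0 < c) :
    sumSlope l m u c < m := by
  rw [sumSlope, div_lt_iff₀ (by positivity)]
  nlinarith

lemma lt_sumSlope_left {l m u c : ℝ} (h : l < m) (hu : 0 < u) (hc : 0 < c) :
    l < sumSlope l m u c := by
  rw [sumSlope, lt_div_iff₀ (by positivity)]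
  nlinarith

lemma sumSlope_lt_iff {l m u u₁ c : ℝ} (h : l < m) (hu : 0 < u) (hu₁ : 0 < u₁) (hc : 0 < c) :
    sumSlope l m u₁ c < sumSlope l m u c ↔ u < u₁ := by
  rw [sumSlope, sumSlope, div_lt_div_iff₀ (by positivity) (by positivity), ← sub_pos]
  have : (l * u + m * c) * (u₁ + c) - (l * u₁ + m * c) * (u + c) =
      (m - l) * c * (u₁ - u) := by ring
  rw [this, mul_pos_iff_of_pos_left (mul_pos (sub_pos.2 h) hc), sub_pos]

lemma sumSlope_inj_right {l m u c c₁ : ℝ} (h : l < m) (hu : 0 < u) (hc : 0 < c) (hc₁ : 0 < c₁)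
    (e : sumSlope l m u c = sumSlope l m u c₁) : c = c₁ := by
  rw [sumSlope, sumSlope, div_eq_div_iff (by positivity) (by positivity)] at e
  have : (m - l) * u * (c - c₁) = 0 := by linear_combination e
  have h2 : (m - l) * u ≠ 0 := (mul_pos (sub_pos.2 h) hu).ne'
  exact sub_eq_zero.1 ((mul_eq_zero.1 this).resolve_left h2)

lemma quadratic_coeffs_eq_zero {p q r x y z : ℝ} (hxy : x ≠ y) (hxz : x ≠ z) (hyz : y ≠ z)
    (hx : p * x ^ 2 + q * x + r = 0) (hy : p * y ^ 2 + q * y + r = 0)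
    (hz : p * z ^ 2 + q * z + r = 0) : p = 0 ∧ q = 0 ∧ r = 0 := by
  have h1 : p * (x + y) + q = 0 := by
    refine (mul_eq_zero.1 (?_ : (x - y) * _ = 0)).resolve_left (sub_ne_zero.2 hxy)
    linear_combination hx - hy
  have h2 : p * (x + z) + q = 0 := by
    refine (mul_eq_zero.1 (?_ : (x - z) * _ = 0)).resolve_left (sub_ne_zero.2 hxz)
    linear_combination hx - hz
  have hp : p = 0 := by
    refine (mul_eq_zero.1 (?_ : (y - z) * _ = 0)).resolve_left (sub_ne_zero.2 hyz)
    linear_combination h1 - h2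
  subst hp
  have hq : q = 0 := by linear_combination h1
  subst hq
  exact ⟨rfl, rfl, by linear_combination hx⟩

/-- Two points in the positive quadrant lie on at most two curves
`sumSlope l m u c = sumSlope l' m' v c'`. -/
lemma card_curves_le_two {l m l' m' : ℝ} (h : l < m) (h' : l' < m') (hne : ¬(l = l' ∧ m = m'))
    (C C' : Finset ℝ) (hC : ∀ c ∈ C, 0 < c) (hC' : ∀ c ∈ C', 0 < c) {u u₁ v v₁ : ℝ}
    (hu : 0 < u) (hv : 0 < v) (huu : u < u₁) (hvv : v < v₁) :
    #{x ∈ C ×ˢ C' | sumSlope l m u x.1 = sumSlope l' m' v x.2 ∧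
      sumSlope l m u₁ x.1 = sumSlope l' m' v₁ x.2} ≤ 2 := by
  have hu₁ := hu.trans huu
  have hv₁ := hv.trans hvv
  have hdet : (l - l') * (m - m') - (l - m') * (m - l') = (m - l) * (m' - l') := by ring
  have hdet0 : 0 < (m - l) * (m' - l') := mul_pos (sub_pos.2 h) (sub_pos.2 h')
  obtain ⟨α, hα⟩ : ∃ α, α = l - l' := ⟨_, rfl⟩
  obtain ⟨β, hβ⟩ : ∃ β, β = l - m' := ⟨_, rfl⟩
  obtain ⟨γ, hγ⟩ : ∃ γ, γ = m - l' := ⟨_, rfl⟩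
  obtain ⟨ε, hε⟩ : ∃ ε, ε = m - m' := ⟨_, rfl⟩
  rw [← hdet, ← hα, ← hβ, ← hγ, ← hε] at hdet0
  have heq : ∀ u v c c' : ℝ, 0 < u → 0 < v → 0 < c → 0 < c' →
      sumSlope l m u c = sumSlope l' m' v c' →
      α * u * v + β * u * c' + γ * c * v + ε * c * c' = 0 := by
    intro u v c c' hu hv hc hc' e
    rw [sumSlope, sumSlope, div_eq_div_iff (by positivity) (by positivity)] at e
    rw [hα, hβ, hγ, hε]
    linear_combination e
  have hquad : ∀ c c' : ℝ, 0 < c → 0 < c' → sumSlope l m u c = sumSlope l' m' v c' →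
      sumSlope l m u₁ c = sumSlope l' m' v₁ c' →
      (γ * ε * (v - v₁)) * c ^ 2 +
        (α * ε * (v * u - v₁ * u₁) + γ * β * (v * u₁ - v₁ * u)) * c +
        α * β * (u * u₁ * (v - v₁)) = 0 := by
    intro c c' hc hc' e1 e2
    have e1 := heq _ _ _ _ hu hv hc hc' e1
    have e2 := heq _ _ _ _ hu₁ hv₁ hc hc' e2
    linear_combination (β * u₁ + ε * c) * e1 - (β * u + ε * c) * e2
  by_contra hcard
  obtain ⟨x, y, z, hx, hy, hz, hxy, hxz, hyz⟩ := two_lt_card_iff.1 (not_le.1 hcard)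
  simp only [mem_filter, mem_product] at hx hy hz
  have hfst : ∀ x y : ℝ × ℝ, 0 < x.1 → 0 < x.2 → 0 < y.2 →
      sumSlope l m u x.1 = sumSlope l' m' v x.2 → sumSlope l m u y.1 = sumSlope l' m' v y.2 →
      x ≠ y → x.1 ≠ y.1 := by
    intro x y _ hx2 hy2 ex ey hne he
    refine hne (Prod.ext he (sumSlope_inj_right h' hv hx2 hy2 ?_))
    rw [← ex, ← ey, he]
  have px1 := hC _ hx.1.1
  have py1 := hC _ hy.1.1
  have pz1 := hC _ hz.1.1
  have px2 := hC' _ hx.1.2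
  have py2 := hC' _ hy.1.2
  have pz2 := hC' _ hz.1.2
  obtain ⟨h1, h2, h3⟩ := quadratic_coeffs_eq_zero
    (hfst x y px1 px2 py2 hx.2.1 hy.2.1 hxy) (hfst x z px1 px2 pz2 hx.2.1 hz.2.1 hxz)
    (hfst y z py1 py2 pz2 hy.2.1 hz.2.1 hyz)
    (hquad _ _ px1 px2 hx.2.1 hx.2.2) (hquad _ _ py1 py2 hy.2.1 hy.2.2)
    (hquad _ _ pz1 pz2 hz.2.1 hz.2.2)
  have hv0 : v - v₁ ≠ 0 := (sub_neg.2 hvv).ne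
  have h1 : γ * ε = 0 := (mul_eq_zero.1 h1).resolve_right hv0
  have h3 : α * β = 0 :=
    (mul_eq_zero.1 h3).resolve_right (mul_ne_zero (mul_pos hu hu₁).ne' hv0)
  rcases mul_eq_zero.1 h1 with hγ0 | hε0
  · rw [hγ0, mul_zero, sub_zero] at hdet0
    rw [hγ0, zero_mul, zero_mul, add_zero] at h2
    have : v * u - v₁ * u₁ < 0 := sub_neg.2 (mul_lt_mul'' hvv huu hv.le hu.le)
    exact mul_ne_zero hdet0.ne' this.ne h2
  · rcases mul_eq_zero.1 h3 with hα0 | hβ0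
    · exact hne ⟨sub_eq_zero.1 (hα ▸ hα0), sub_eq_zero.1 (hε ▸ hε0)⟩
    · simp [hε0, hβ0] at hdet0

/-- Coincidences between the sums coming from two distinct pairs of lines. -/
lemma card_coincidences_le {l m l' m' : ℝ} (h : l < m) (h' : l' < m') (hne : ¬(l = l' ∧ m = m'))
    {B C B' C' : Finset ℝ} (hB : ∀ c ∈ B, 0 < c) (hC : ∀ c ∈ C, 0 < c) (hB' : ∀ c ∈ B', 0 < c)
    (hC' : ∀ c ∈ C', 0 < c) {t D : ℕ} (hD : 0 < D) (tB : #B = t) (tC : #C = t) (tB' : #B' = t)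
    (tC' : #C' = t) :
    #{w ∈ (B ×ˢ C) ×ˢ (B' ×ˢ C') |
      sumSlope l m w.1.1 w.1.2 = sumSlope l' m' w.2.1 w.2.2} ≤
      t ^ 2 * (2 * (t / D) + 1) + 2 * (t ^ 2 * D ^ 2) := by
  have key := card_incidences_le (C ×ˢ C') B B'
    (fun x u v => sumSlope l m u x.1 = sumSlope l' m' v x.2) (k := 2) hD tB tB' ?_ ?_
  · rw [card_product, tC, tC', ← sq] at key
    refine le_trans (card_le_card_of_injOn
      (fun w => ((w.1.2, w.2.2), (w.1.1, w.2.1))) ?_ ?_) key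
    · intro w hw
      simp only [coe_filter, mem_product, Set.mem_ofPred_eq] at hw ⊢
      tauto
    · rintro ⟨⟨a, b⟩, c, d⟩ _ ⟨⟨a', b'⟩, c', d'⟩ _ e
      simp only [Prod.mk.injEq] at e ⊢
      tauto
  · intro x hx u hu u₁ hu₁ v hv v₁ hv₁ e e₁
    have hx := mem_product.1 hx
    rw [← sumSlope_lt_iff h (hB _ hu) (hB _ hu₁) (hC _ hx.1), e, e₁,
      sumSlope_lt_iff h' (hB' _ hv) (hB' _ hv₁) (hC' _ hx.2)]
  · intro u hu u₁ _ v hv v₁ _ huu hvv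
    exact card_curves_le_two h h' hne C C' hC hC' (hB _ hu) (hB' _ hv) huu hvv

lemma card_coincidences_self_le {l m : ℝ} (h : l < m) {B C : Finset ℝ} (hB : ∀ c ∈ B, 0 < c)
    (hC : ∀ c ∈ C, 0 < c) {t : ℕ} (tB : #B = t) (tC : #C = t) :
    #{w ∈ (B ×ˢ C) ×ˢ (B ×ˢ C) |
      sumSlope l m w.1.1 w.1.2 = sumSlope l m w.2.1 w.2.2} ≤ t ^ 3 := by
  have : #((B ×ˢ C) ×ˢ B) = t ^ 3 := by
    rw [card_product, card_product, tB, tC]; ring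
  rw [← this]
  refine card_le_card_of_injOn (fun w => (w.1, w.2.1)) ?_ ?_
  · intro w hw
    simp only [coe_filter, mem_product, Set.mem_ofPred_eq, coe_product, Set.mem_prod, mem_coe]
      at hw ⊢
    tauto
  · rintro ⟨p, c, d⟩ h1 ⟨p', c', d'⟩ h2 e
    simp only [coe_filter, mem_product, Set.mem_ofPred_eq] at h1 h2
    simp only [Prod.mk.injEq] at e ⊢
    obtain ⟨rfl, rfl⟩ := e
    refine ⟨rfl, rfl, sumSlope_inj_right h (hB _ h1.1.2.1) (hC _ h1.1.2.2) (hC _ h2.1.2.2) ?_⟩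
    rw [← h1.2, ← h2.2]

lemma sq_card_le_card_image_mul {α β : Type*} (s : Finset α) (f : α → β) :
    #s ^ 2 ≤ #(s.image f) * #{w ∈ s ×ˢ s | f w.1 = f w.2} := by
  have h1 : #s = ∑ z ∈ s.image f, #{x ∈ s | f x = z} :=
    card_eq_sum_card_fiberwise fun x hx => mem_image_of_mem f hx
  have h2 : #{w ∈ s ×ˢ s | f w.1 = f w.2} = ∑ z ∈ s.image f, #{x ∈ s | f x = z} ^ 2 := by
    rw [card_eq_sum_card_fiberwise (f := fun w => f w.1) (t := s.image f)
      fun x hx => mem_image_of_mem f (mem_product.1 (mem_filter.1 hx).1).1]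
    refine sum_congr rfl fun z _ => ?_
    rw [sq, ← card_product]
    congr 1
    ext w
    simp only [mem_filter, mem_product]
    constructor
    · rintro ⟨⟨⟨a, b⟩, c⟩, d⟩
      exact ⟨⟨a, d⟩, b, c ▸ d⟩
    · rintro ⟨⟨a, b⟩, c, d⟩
      exact ⟨⟨⟨a, c⟩, b.trans d.symm⟩, b⟩
  rw [h2]
  conv_lhs => rw [h1]
  exact sq_sum_le_card_mul_sum_sq

/-- The slopes of all sums of a point on a line from `U` and a point on a line from `U'`. -/
noncomputable def slopeSet (U U' : Finset ℝ) (B : ℝ → Finset ℝ) : Finset ℝ :=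
  ((U ×ˢ U').sigma fun p => B p.1 ×ˢ B p.2).image fun x => sumSlope x.1.1 x.1.2 x.2.1 x.2.2

lemma card_slopeSet {U U' : Finset ℝ} {B : ℝ → Finset ℝ} {M t : ℕ} (hM : 1 ≤ M) (ht : M ^ 6 ≤ t)
    (hU : #U = M) (hU' : #U' = M) (hlt : ∀ l ∈ U, ∀ m ∈ U', l < m)
    (hB : ∀ l ∈ U ∪ U', #(B l) = t ∧ ∀ c ∈ B l, 0 < c) :
    M ^ 2 * t ≤ 6 * #(slopeSet U U' B) := by
  set P := U ×ˢ U' with hP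
  set Ω := P.sigma fun p => B p.1 ×ˢ B p.2 with hΩ
  have hPcard : #P = M ^ 2 := by rw [hP, card_product, hU, hU', sq]
  have hPB : ∀ p ∈ P, (#(B p.1) = t ∧ ∀ c ∈ B p.1, 0 < c) ∧ (#(B p.2) = t ∧ ∀ c ∈ B p.2, 0 < c) ∧
      p.1 < p.2 := by
    intro p hp
    have hp := mem_product.1 hp
    exact ⟨hB _ (mem_union_left _ hp.1), hB _ (mem_union_right _ hp.2), hlt _ hp.1 _ hp.2⟩
  have hΩcard : #Ω = M ^ 2 * t ^ 2 := by
    rw [hΩ, card_sigma, sum_congr rfl (g := fun _ => t ^ 2), sum_const, hPcard, smul_eq_mul]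
    intro p hp
    rw [card_product, (hPB p hp).1.1, (hPB p hp).2.1.1, sq]
  set I := t ^ 2 * (2 * (t / M ^ 2) + 1) + 2 * (t ^ 2 * (M ^ 2) ^ 2) with hI
  have hcoll : #{w ∈ Ω ×ˢ Ω | sumSlope w.1.1.1 w.1.1.2 w.1.2.1 w.1.2.2 =
      sumSlope w.2.1.1 w.2.1.2 w.2.2.1 w.2.2.2} ≤ M ^ 2 * t ^ 3 + M ^ 4 * I := by
    calc _ = ∑ p ∈ P, ∑ q ∈ P, #{w ∈ (B p.1 ×ˢ B p.2) ×ˢ (B q.1 ×ˢ B q.2) |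
            sumSlope p.1 p.2 w.1.1 w.1.2 = sumSlope q.1 q.2 w.2.1 w.2.2} := by
          rw [card_filter, sum_product, hΩ, sum_sigma]
          refine sum_congr rfl fun p _ => ?_
          simp_rw [card_filter, sum_sigma]
          rw [sum_comm]
          exact sum_congr rfl fun q _ => by
            rw [sum_product (B p.1 ×ˢ B p.2)]
      _ ≤ ∑ p ∈ P, ∑ q ∈ P, ((if p = q then t ^ 3 else 0) + I) := by
          refine sum_le_sum fun p hp => sum_le_sum fun q hq => ?_
          obtain ⟨⟨p1, p2⟩, ⟨p3, p4⟩, p5⟩ := hPB p hp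
          obtain ⟨⟨q1, q2⟩, ⟨q3, q4⟩, q5⟩ := hPB q hq
          split_ifs with hpq
          · subst hpq
            exact (card_coincidences_self_le p5 p2 p4 p1 p3).trans (Nat.le_add_right _ _)
          · rw [zero_add]
            exact card_coincidences_le p5 q5 (fun e => hpq (Prod.ext e.1 e.2)) p2 p4 q2 q4
              (by positivity) p1 p3 q1 q3
      _ = M ^ 2 * t ^ 3 + M ^ 4 * I := by
          simp only [sum_add_distrib, sum_ite_eq, sum_const, smul_eq_mul, hPcard]
          rw [sum_congr rfl (g := fun _ => t ^ 3) (fun p hp => by simp [hp]), sum_const, hPcard,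
            smul_eq_mul]
          ring
  have hbound : M ^ 4 * I ≤ 5 * (M ^ 2 * t ^ 3) := by
    have h1 : M ^ 2 * (t / M ^ 2) ≤ t := Nat.mul_div_le _ _
    have h2 : M ^ 2 ≤ t := le_trans (Nat.pow_le_pow_right hM (by norm_num)) ht
    calc M ^ 4 * I = M ^ 2 * t ^ 2 * (2 * (M ^ 2 * (t / M ^ 2)) + M ^ 2 + 2 * M ^ 6) := by
          rw [hI]; ring
      _ ≤ M ^ 2 * t ^ 2 * (2 * t + t + 2 * t) := by gcongr
      _ = 5 * (M ^ 2 * t ^ 3) := by ring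
  have hcs := sq_card_le_card_image_mul Ω fun x => sumSlope x.1.1 x.1.2 x.2.1 x.2.2
  have htpos : 0 < t := lt_of_lt_of_le (by positivity) ht
  have hfin : (M ^ 2 * t ^ 3) * (M ^ 2 * t) ≤ (M ^ 2 * t ^ 3) * (6 * #(slopeSet U U' B)) := by
    calc (M ^ 2 * t ^ 3) * (M ^ 2 * t) = #Ω ^ 2 := by rw [hΩcard]; ring
      _ ≤ #(slopeSet U U' B) * (M ^ 2 * t ^ 3 + M ^ 4 * I) :=
          hcs.trans (Nat.mul_le_mul_left _ hcoll)
      _ ≤ #(slopeSet U U' B) * (M ^ 2 * t ^ 3 + 5 * (M ^ 2 * t ^ 3)) := by gcongr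
      _ = (M ^ 2 * t ^ 3) * (6 * #(slopeSet U U' B)) := by ring
  exact Nat.le_of_mul_le_mul_left hfin (by positivity)

lemma mem_quotSumSet {A : Finset ℝ} {a b c d : ℝ} (ha : a ∈ A) (hb : b ∈ A) (hc : c ∈ A)
    (hd : d ∈ A) (h : c + d ≠ 0) : (a + b) / (c + d) ∈ quotSumSet A :=
  mem_image.2 ⟨((a, b), (c, d)), by simp [ha, hb, hc, hd, h], rfl⟩

lemma mem_slopeSet {U U' : Finset ℝ} {B : ℝ → Finset ℝ} {z : ℝ} :
    z ∈ slopeSet U U' B ↔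
      ∃ l ∈ U, ∃ m ∈ U', ∃ u ∈ B l, ∃ c ∈ B m, sumSlope l m u c = z := by
  simp only [slopeSet, mem_image, mem_sigma, mem_product, Sigma.exists, Prod.exists]
  constructor
  · rintro ⟨l, m, u, c, ⟨⟨hl, hm⟩, hu, hc⟩, h⟩
    exact ⟨l, hl, m, hm, u, hu, c, hc, h⟩
  · rintro ⟨l, hl, m, hm, u, hu, c, hc, h⟩
    exact ⟨l, m, u, c, ⟨⟨hl, hm⟩, hu, hc⟩, h⟩

/-- The points `x` of `A` such that the line of slope `l` passes through a point of `A × A` of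
abscissa `x`. -/
noncomputable def fiber (A : Finset ℝ) (l : ℝ) : Finset ℝ := {x ∈ A | l * x ∈ A}

/-- If many slopes are rich, then the quotient set of sums is large. -/
lemma card_mul_le_card_quotSumSet {A S : Finset ℝ} (hA : ∀ a ∈ A, 0 < a) {M t : ℕ} (hM : 1 ≤ M)
    (ht : M ^ 6 ≤ t) (hS : 2 * M ≤ #S) (hrich : ∀ l ∈ S, t ≤ #(fiber A l)) :
    #S * M * t ≤ 24 * #(quotSumSet A) := by
  have : ∀ l : ℝ, ∃ B : Finset ℝ, l ∈ S → B ⊆ fiber A l ∧ #B = t := by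
    intro l
    by_cases hl : l ∈ S
    · obtain ⟨B, hB⟩ := exists_subset_card_eq (hrich l hl)
      exact ⟨B, fun _ => hB⟩
    · exact ⟨∅, fun h => absurd h hl⟩
  choose B hB using this
  have hBA : ∀ l ∈ S, ∀ x ∈ B l, x ∈ A ∧ l * x ∈ A := fun l hl x hx =>
    mem_filter.1 ((hB l hl).1 hx)
  set k := #S / (2 * M) with hk
  have hkS : k * (2 * M) ≤ #S := Nat.div_mul_le_self _ _
  set U : ℕ → Finset ℝ := fun j => {x ∈ S | rank S x ∈ Ico (j * (2 * M)) (j * (2 * M) + M)}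
    with hU
  set U' : ℕ → Finset ℝ :=
    fun j => {x ∈ S | rank S x ∈ Ico (j * (2 * M) + M) ((j + 1) * (2 * M))} with hU'
  have hle : ∀ j ∈ range k, (j + 1) * (2 * M) ≤ #S := fun j hj =>
    le_trans (Nat.mul_le_mul_right _ (mem_range.1 hj)) hkS
  have hUmem : ∀ j x, x ∈ U j ↔ x ∈ S ∧ j * (2 * M) ≤ rank S x ∧ rank S x < j * (2 * M) + M := by
    intro j x; simp [hU]
  have hU'mem : ∀ j x, x ∈ U' j ↔
      x ∈ S ∧ j * (2 * M) + M ≤ rank S x ∧ rank S x < (j + 1) * (2 * M) := by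
    intro j x; simp [hU']
  have hUU' : ∀ j, ∀ l ∈ U j, ∀ m ∈ U' j, l < m := by
    intro j l hl m hm
    refine (rank_mono S).reflect_lt (lt_of_lt_of_le ((hUmem _ _).1 hl).2.2 ((hU'mem _ _).1 hm).2.1)
  have hcard : ∀ j ∈ range k, M ^ 2 * t ≤ 6 * #(slopeSet (U j) (U' j) B) := by
    intro j hj
    have h1 := hle j hj
    have h2 : (j + 1) * (2 * M) = j * (2 * M) + M + M := by ring
    refine card_slopeSet hM ht ?_ ?_ (hUU' j) ?_
    · refine (card_filter_rank_mem fun i hi => ?_).trans (by simp)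
      rw [mem_Ico] at hi
      rw [mem_range]
      omega
    · refine (card_filter_rank_mem fun i hi => ?_).trans (by rw [Nat.card_Ico]; omega)
      rw [mem_Ico] at hi
      rw [mem_range]
      omega
    · intro l hl
      have hlS : l ∈ S := by
        rcases mem_union.1 hl with hl | hl
        · exact ((hUmem _ _).1 hl).1
        · exact ((hU'mem _ _).1 hl).1
      exact ⟨(hB l hlS).2, fun c hc => hA _ (hBA l hlS c hc).1⟩
  have hbetween : ∀ j, ∀ z ∈ slopeSet (U j) (U' j) B, ∃ l ∈ U j, ∃ m ∈ U' j, l < z ∧ z < m := by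
    intro j z hz
    obtain ⟨l, hl, m, hm, u, hu, c, hc, rfl⟩ := mem_slopeSet.1 hz
    have hlm := hUU' j l hl m hm
    have hu := hA _ (hBA l ((hUmem _ _).1 hl).1 u hu).1
    have hc := hA _ (hBA m ((hU'mem _ _).1 hm).1 c hc).1
    exact ⟨l, hl, m, hm, lt_sumSlope_left hlm hu hc, sumSlope_lt_right hlm hu hc⟩
  have hlt : ∀ i j, i < j → Disjoint (slopeSet (U i) (U' i) B) (slopeSet (U j) (U' j) B) := by
    intro i j hij
    rw [disjoint_left]
    intro z hz hz'
    obtain ⟨_, _, m, hm, _, hzm⟩ := hbetween i z hz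
    obtain ⟨l, hl, _, _, hlz, _⟩ := hbetween j z hz'
    have h1 := rank_mono S (hlz.trans hzm).le
    have h2 := ((hU'mem _ _).1 hm).2.2
    have h3 := ((hUmem _ _).1 hl).2.1
    have h4 : (i + 1) * (2 * M) ≤ j * (2 * M) := Nat.mul_le_mul_right _ hij
    omega
  have hsub : (range k).biUnion (fun j => slopeSet (U j) (U' j) B) ⊆ quotSumSet A := by
    intro z hz
    obtain ⟨j, -, hz⟩ := mem_biUnion.1 hz
    obtain ⟨l, hl, m, hm, u, hu, c, hc, rfl⟩ := mem_slopeSet.1 hz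
    have hu := hBA l ((hUmem _ _).1 hl).1 u hu
    have hc := hBA m ((hU'mem _ _).1 hm).1 c hc
    exact mem_quotSumSet hu.2 hc.2 hu.1 hc.1 (add_pos (hA _ hu.1) (hA _ hc.1)).ne'
  have hsum : k * (M ^ 2 * t) ≤ 6 * #(quotSumSet A) := by
    calc k * (M ^ 2 * t) = ∑ j ∈ range k, M ^ 2 * t := by simp
      _ ≤ ∑ j ∈ range k, 6 * #(slopeSet (U j) (U' j) B) := sum_le_sum hcard
      _ = 6 * #((range k).biUnion fun j => slopeSet (U j) (U' j) B) := by
          rw [← mul_sum, card_biUnion]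
          intro i _ j _ hij
          rcases lt_or_gt_of_ne hij with h | h
          · exact hlt i j h
          · exact (hlt j i h).symm
      _ ≤ 6 * #(quotSumSet A) := Nat.mul_le_mul_left _ (card_le_card hsub)
  have hSk : #S ≤ 4 * M * k := by
    have h1 : #S < (k + 1) * (2 * M) := Nat.lt_mul_of_div_lt (Nat.lt_succ_self _) (by positivity)
    have h2 : 1 ≤ k := (Nat.one_le_div_iff (by positivity)).2 hS
    have h3 : (k + 1) * (2 * M) ≤ (k + k) * (2 * M) := by gcongr
    nlinarith
  calc #S * M * t ≤ 4 * M * k * M * t := by gcongr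
    _ = 4 * (k * (M ^ 2 * t)) := by ring
    _ ≤ 4 * (6 * #(quotSumSet A)) := by gcongr
    _ = 24 * #(quotSumSet A) := by ring

lemma sum_card_fiber {A : Finset ℝ} (hA : ∀ a ∈ A, 0 < a) :
    ∑ l ∈ ratioSet A, #(fiber A l) = #A ^ 2 := by
  have : #A ^ 2 = #(A ×ˢ A) := by rw [card_product, sq]
  rw [this, card_eq_sum_card_fiberwise (f := fun p : ℝ × ℝ => p.2 / p.1) (t := ratioSet A)]
  · refine sum_congr rfl fun l _ => ?_
    refine card_bij (fun x _ => (x, l * x)) ?_ ?_ ?_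
    · intro x hx
      have hx := mem_filter.1 hx
      have h0 := (hA x hx.1).ne'
      simp [hx.1, hx.2, h0]
    · intro x _ y _ h
      exact (Prod.ext_iff.1 h).1
    · rintro ⟨x, y⟩ h
      simp only [mem_filter, mem_product] at h
      have h0 := (hA x h.1.1).ne'
      have : l * x = y := by rw [← h.2]; field_simp
      exact ⟨x, mem_filter.2 ⟨h.1.1, this ▸ h.1.2⟩, by rw [this]⟩
  · rintro ⟨x, y⟩ h
    have h := mem_product.1 h
    exact mem_image.2 ⟨(y, x), by simp [h.1, h.2, (hA x h.1).ne'], rfl⟩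

lemma sq_card_le {A : Finset ℝ} (hA : ∀ a ∈ A, 0 < a) {M : ℕ} (hM : 1 ≤ M) :
    (#A : ℝ) ^ 2 ≤ ((M : ℝ) ^ 6 - 1) * #(ratioSet A) + 2 * M * #A +
      24 * #(quotSumSet A) / M * (1 + Real.log #A) := by
  set S : ℕ → Finset ℝ := fun t => {l ∈ ratioSet A | t ≤ #(fiber A l)} with hS
  have hlayer : #A ^ 2 = ∑ t ∈ Icc 1 #A, #(S t) := by
    rw [← sum_card_fiber hA]
    simp only [hS, card_filter]
    rw [sum_comm]
    refine sum_congr rfl fun l _ => ?_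
    have hle : #(fiber A l) ≤ #A := card_le_card (filter_subset _ _)
    rw [← card_filter]
    have : {t ∈ Icc 1 #A | t ≤ #(fiber A l)} = Icc 1 #(fiber A l) := by
      ext t
      simp only [mem_filter, mem_Icc]
      omega
    rw [this, Nat.card_Icc, Nat.add_sub_cancel]
  have hM0 : (0 : ℝ) < M := by exact_mod_cast hM
  have hbound : ∀ t ∈ Icc 1 #A, (#(S t) : ℝ) ≤
      (if t < M ^ 6 then (#(ratioSet A) : ℝ) else 0) +
        (2 * M + 24 * #(quotSumSet A) / M * (t : ℝ)⁻¹) := by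
    intro t ht
    have ht0 : (0 : ℝ) < t := by exact_mod_cast (mem_Icc.1 ht).1
    split_ifs with htM
    · have : (#(S t) : ℝ) ≤ #(ratioSet A) := by exact_mod_cast card_le_card (filter_subset _ _)
      have : (0 : ℝ) ≤ 2 * M + 24 * #(quotSumSet A) / M * (t : ℝ)⁻¹ := by positivity
      linarith
    · rw [zero_add]
      by_cases hcard : 2 * M ≤ #(S t)
      · have h := card_mul_le_card_quotSumSet hA hM (not_lt.1 htM) hcard
          fun l hl => (mem_filter.1 hl).2
        have h : (#(S t) : ℝ) * M * t ≤ 24 * #(quotSumSet A) := by exact_mod_cast h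
        have : (#(S t) : ℝ) ≤ 24 * #(quotSumSet A) / M * (t : ℝ)⁻¹ := by
          rw [← div_eq_mul_inv, div_div, le_div_iff₀ (by positivity)]
          linarith
        linarith
      · have : (#(S t) : ℝ) ≤ 2 * M := by exact_mod_cast (not_le.1 hcard).le
        have : (0 : ℝ) ≤ 24 * #(quotSumSet A) / M * (t : ℝ)⁻¹ := by positivity
        linarith
  have hsmall : (#{t ∈ Icc 1 #A | t < M ^ 6} : ℝ) ≤ (M : ℝ) ^ 6 - 1 := by
    have h1 : #{t ∈ Icc 1 #A | t < M ^ 6} ≤ #(Ico 1 (M ^ 6)) := by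
      refine card_le_card fun t ht => ?_
      simp only [mem_filter, mem_Icc] at ht
      exact mem_Ico.2 ⟨ht.1.1, ht.2⟩
    rw [Nat.card_Ico] at h1
    have h2 : 1 ≤ M ^ 6 := Nat.one_le_pow _ _ hM
    have h1 : #{t ∈ Icc 1 #A | t < M ^ 6} + 1 ≤ M ^ 6 := by omega
    have h1 : (#{t ∈ Icc 1 #A | t < M ^ 6} : ℝ) + 1 ≤ (M : ℝ) ^ 6 := by exact_mod_cast h1
    linarith
  have hharm : ∑ t ∈ Icc 1 #A, (t : ℝ)⁻¹ ≤ 1 + Real.log #A := by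
    have := harmonic_le_one_add_log #A
    rw [harmonic_eq_sum_Icc] at this
    push_cast at this
    exact_mod_cast this
  calc (#A : ℝ) ^ 2 = ∑ t ∈ Icc 1 #A, (#(S t) : ℝ) := by exact_mod_cast hlayer
    _ ≤ ∑ t ∈ Icc 1 #A, ((if t < M ^ 6 then (#(ratioSet A) : ℝ) else 0) +
        (2 * M + 24 * #(quotSumSet A) / M * (t : ℝ)⁻¹)) := sum_le_sum hbound
    _ = #{t ∈ Icc 1 #A | t < M ^ 6} * (#(ratioSet A) : ℝ) + 2 * M * #A +
        24 * #(quotSumSet A) / M * ∑ t ∈ Icc 1 #A, (t : ℝ)⁻¹ := by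
        rw [sum_add_distrib, sum_add_distrib, ← sum_filter, sum_const, sum_const, ← mul_sum,
          Nat.card_Icc, nsmul_eq_mul, nsmul_eq_mul, Nat.add_sub_cancel]
        ring
    _ ≤ _ := by gcongr

lemma card_le_card_ratioSet {A : Finset ℝ} (hA : ∀ a ∈ A, 0 < a) : #A ≤ #(ratioSet A) := by
  rcases A.eq_empty_or_nonempty with rfl | ⟨a, ha⟩
  · simp
  · refine card_le_card_of_injOn (· / a) (fun x hx => ?_) fun x _ y _ h => ?_
    · exact mem_image.2 ⟨(x, a), by simp [ha, mem_coe.1 hx, (hA a ha).ne'], rfl⟩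
    · exact (div_left_inj' (hA a ha).ne').1 h

lemma card_ratioSet_le (A : Finset ℝ) : #(ratioSet A) ≤ #A ^ 2 := by
  rw [sq, ← card_product]
  exact card_image_le.trans (card_filter_le _ _)

/-- The bound for sets of positive numbers. -/
lemma sq_card_mul_rpow_le {A : Finset ℝ} (hA : ∀ a ∈ A, 0 < a) (hne : A.Nonempty) :
    (#A : ℝ) ^ 2 * ((#A : ℝ) ^ 2 / #(ratioSet A)) ^ ((1 : ℝ) / 25) ≤
      512 * #(quotSumSet A) * (1 + Real.log #A) := by
  obtain ⟨a, ha⟩ := hne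
  have hN : (1 : ℝ) ≤ #A := by exact_mod_cast card_pos.2 ⟨a, ha⟩
  have hQ : (1 : ℝ) ≤ #(quotSumSet A) := by
    exact_mod_cast card_pos.2 ⟨_, mem_quotSumSet ha ha ha ha (add_pos (hA a ha) (hA a ha)).ne'⟩
  have hlog : 0 ≤ Real.log #A := Real.log_nonneg hN
  have hKN : (#A : ℝ) ≤ #(ratioSet A) := by exact_mod_cast card_le_card_ratioSet hA
  have hKN2 : (#(ratioSet A) : ℝ) ≤ (#A : ℝ) ^ 2 := by exact_mod_cast card_ratioSet_le A
  have hmain := fun M (hM : 1 ≤ M) => sq_card_le hA hM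
  have hnat : #A < 8 ∨ (8 : ℝ) ≤ #A := by
    rcases lt_or_ge #A 8 with h | h
    · exact Or.inl h
    · exact Or.inr (by exact_mod_cast h)
  have hnat' : #A < 8 → (#A : ℝ) ≤ 8 := fun h => by exact_mod_cast h.le
  generalize (#A : ℝ) = N at *
  generalize (#(ratioSet A) : ℝ) = K at *
  generalize (#(quotSumSet A) : ℝ) = Q at *
  have hK0 : 0 < K := by linarith
  have hR1 : 1 ≤ N ^ 2 / K := (one_le_div hK0).2 hKN2
  have hRN : N ^ 2 / K ≤ N := by
    rw [div_le_iff₀ hK0, sq]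
    gcongr
  have hRK : N ^ 2 / K * K = N ^ 2 := div_mul_cancel₀ _ hK0.ne'
  generalize N ^ 2 / K = R at *
  set ρ := R ^ ((1 : ℝ) / 25) with hρ
  have hρ1 : 1 ≤ ρ := Real.one_le_rpow hR1 (by norm_num)
  have hρR : ρ ≤ R := Real.rpow_le_self_of_one_le hR1 (by norm_num)
  have hρ6 : ρ ^ 6 ≤ R := by
    have : ρ ^ 6 ≤ ρ ^ 25 := pow_le_pow_right₀ hρ1 (by norm_num)
    refine this.trans (le_of_eq ?_)
    rw [hρ, ← Real.rpow_natCast, ← Real.rpow_mul (by linarith)]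
    norm_num
  rcases hnat with h8 | h8
  · have h8 := hnat' h8
    calc N ^ 2 * ρ ≤ 8 ^ 2 * 8 := by
          gcongr
          linarith
      _ = 512 * 1 * (1 + 0) := by norm_num
      _ ≤ 512 * Q * (1 + Real.log N) := by gcongr
  · obtain ⟨M, hM1, hMρ, hM6, hMN⟩ : ∃ M : ℕ, 1 ≤ M ∧ ρ / 4 ≤ M ∧
        ((M : ℝ) ^ 6 - 1) * K ≤ N ^ 2 / 4 ∧ (M : ℝ) ≤ N / 8 := by
      by_cases hρ4 : ρ ≤ 4
      · refine ⟨1, le_rfl, by norm_num; linarith, ?_, by norm_num; linarith⟩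
        have : 0 ≤ N ^ 2 / 4 := by positivity
        simpa using this
      · have hρ4 := not_le.1 hρ4
        have h1 : (⌊ρ / 2⌋₊ : ℝ) ≤ ρ / 2 := Nat.floor_le (by linarith)
        have h2 : ρ / 2 < ⌊ρ / 2⌋₊ + 1 := Nat.lt_floor_add_one _
        have h3 : (⌊ρ / 2⌋₊ : ℝ) ^ 6 ≤ R / 64 := by
          calc (⌊ρ / 2⌋₊ : ℝ) ^ 6 ≤ (ρ / 2) ^ 6 := by gcongr
            _ = ρ ^ 6 / 64 := by ring
            _ ≤ R / 64 := by gcongr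
        have h4 : ρ * 32 ≤ R := by
          calc ρ * 32 ≤ ρ * ρ ^ 5 := by
                gcongr
                calc (32 : ℝ) ≤ 4 ^ 5 := by norm_num
                  _ ≤ ρ ^ 5 := by gcongr
            _ = ρ ^ 6 := by ring
            _ ≤ R := hρ6
        refine ⟨⌊ρ / 2⌋₊, Nat.floor_pos.2 (by linarith), by linarith, ?_, by linarith⟩
        calc _ ≤ R / 64 * K := by gcongr; linarith
          _ = N ^ 2 / 64 := by rw [← hRK]; ring
          _ ≤ N ^ 2 / 4 := by gcongr; norm_num
    have hM0 : (0 : ℝ) < M := by exact_mod_cast hM1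
    have h1 := hmain M hM1
    have h2 : 2 * M * N ≤ N ^ 2 / 4 := by nlinarith
    have h3 : N ^ 2 / 2 ≤ 24 * Q / M * (1 + Real.log N) := by linarith
    rw [div_mul_eq_mul_div, le_div_iff₀ hM0] at h3
    have h4 : N ^ 2 * (ρ / 4) ≤ N ^ 2 * M := by gcongr
    have h5 : 0 ≤ Q * (1 + Real.log N) := by positivity
    nlinarith

lemma quotSumSet_subset {A P : Finset ℝ} {e : ℝ} (he : e ≠ 0) (h : ∀ x ∈ P, e * x ∈ A) :
    quotSumSet P ⊆ quotSumSet A := by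
  intro z hz
  obtain ⟨⟨⟨a, b⟩, c, d⟩, hp, rfl⟩ := mem_image.1 hz
  simp only [mem_filter, mem_product] at hp
  have : (a + b) / (c + d) = (e * a + e * b) / (e * c + e * d) := by
    rw [← mul_add, ← mul_add, mul_div_mul_left _ _ he]
  simp only [this]
  refine mem_quotSumSet (h _ hp.1.1.1) (h _ hp.1.1.2) (h _ hp.1.2.1) (h _ hp.1.2.2) ?_
  rw [← mul_add]
  exact mul_ne_zero he hp.2

lemma ratioSet_subset {A P : Finset ℝ} {e : ℝ} (he : e ≠ 0) (h : ∀ x ∈ P, e * x ∈ A) :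
    ratioSet P ⊆ ratioSet A := by
  intro z hz
  obtain ⟨⟨a, b⟩, hp, rfl⟩ := mem_image.1 hz
  simp only [mem_filter, mem_product] at hp
  refine mem_image.2 ⟨(e * a, e * b), ?_, mul_div_mul_left _ _ he⟩
  simp [h _ hp.1.1, h _ hp.1.2, he, hp.2]

lemma exists_pos_part {A : Finset ℝ} (hA : 2 ≤ #A) :
    ∃ (P : Finset ℝ) (e : ℝ), e ≠ 0 ∧ (∀ x ∈ P, e * x ∈ A) ∧ (∀ x ∈ P, 0 < x) ∧ #A ≤ 3 * #P := by
  have hcov : #A ≤ #{x ∈ A | 0 < x} + #{x ∈ A | x < 0} + 1 := by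
    have : A ⊆ ({x ∈ A | 0 < x} ∪ {x ∈ A | x < 0}) ∪ {0} := by
      intro x hx
      rcases lt_trichotomy x 0 with h | h | h <;> simp [hx, h]
    refine (card_le_card this).trans ((card_union_le _ _).trans ?_)
    exact add_le_add (card_union_le _ _) (by simp)
  by_cases h : #{x ∈ A | x < 0} ≤ #{x ∈ A | 0 < x}
  · refine ⟨{x ∈ A | 0 < x}, 1, one_ne_zero, fun x hx => ?_, fun x hx => (mem_filter.1 hx).2, ?_⟩
    · rw [one_mul]
      exact (mem_filter.1 hx).1
    · omega
  · refine ⟨{x ∈ A | x < 0}.image (- ·), -1, by norm_num, fun x hx => ?_, fun x hx => ?_, ?_⟩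
    · obtain ⟨y, hy, rfl⟩ := mem_image.1 hx
      simpa using (mem_filter.1 hy).1
    · obtain ⟨y, hy, rfl⟩ := mem_image.1 hx
      simpa using (mem_filter.1 hy).2
    · rw [card_image_of_injective _ neg_injective]
      omega

end QuotSum

theorem stmt0 :
    ∃ c : ℝ, 0 < c ∧ ∀ A : Finset ℝ, 2 ≤ A.card →
      ((quotSumSet A).card : ℝ) ≥
        c * (A.card : ℝ) ^ ((52 : ℝ) / 25) /
          (((ratioSet A).card : ℝ) ^ ((1 : ℝ) / 25) * Real.logb 2 (A.card)) := by
  refine ⟨1 / 82944, by norm_num, fun A hA => ?_⟩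
  obtain ⟨P, e, he, hPA, hpos, hcard⟩ := QuotSum.exists_pos_part hA
  have hPcard : 0 < P.card := by omega
  have hP := QuotSum.sq_card_mul_rpow_le hpos (Finset.card_pos.1 hPcard)
  have hQ : ((quotSumSet P).card : ℝ) ≤ (quotSumSet A).card := by
    exact_mod_cast Finset.card_le_card (QuotSum.quotSumSet_subset he hPA)
  have hK : ((ratioSet P).card : ℝ) ≤ (ratioSet A).card := by
    exact_mod_cast Finset.card_le_card (QuotSum.ratioSet_subset he hPA)
  have hKP : (P.card : ℝ) ≤ (ratioSet P).card := by
    exact_mod_cast QuotSum.card_le_card_ratioSet hpos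
  have hPA' : (P.card : ℝ) ≤ A.card := by
    have : P.card ≤ A.card := Finset.card_le_card_of_injOn (e * ·) hPA
      fun x _ y _ h => mul_left_cancel₀ he h
    exact_mod_cast this
  have hcard : (A.card : ℝ) ≤ 3 * P.card := by exact_mod_cast hcard
  have hN : (1 : ℝ) ≤ P.card := by exact_mod_cast hPcard
  have hn : (2 : ℝ) ≤ A.card := by exact_mod_cast hA
  have hQ0 : (0 : ℝ) ≤ (quotSumSet P).card := by positivity
  generalize (A.card : ℝ) = n at *
  generalize (P.card : ℝ) = N at *
  generalize ((ratioSet A).card : ℝ) = K at *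
  generalize ((ratioSet P).card : ℝ) = K' at *
  generalize ((quotSumSet A).card : ℝ) = Q at *
  generalize ((quotSumSet P).card : ℝ) = Q' at *
  have hK'0 : 0 < K' := by linarith
  have hK0 : 0 < K := by linarith
  have hlogb : 1 ≤ Real.logb 2 n := by
    rw [Real.le_logb_iff_rpow_le (by norm_num) (by linarith)]
    simpa using hn
  have hlog : Real.log N ≤ Real.logb 2 n := by
    have h1 : Real.log N ≤ Real.log n := Real.log_le_log (by linarith) hPA'
    have h2 : Real.log n ≤ Real.logb 2 n := by
      have h3 : Real.log 2 ≤ 1 := by linarith [Real.log_two_lt_d9]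
      rw [Real.logb, le_div_iff₀ (Real.log_pos (by norm_num))]
      nlinarith [Real.log_nonneg (show (1 : ℝ) ≤ n by linarith)]
    linarith
  have hsplit : n ^ ((52 : ℝ) / 25) = n ^ 2 * (n ^ 2) ^ ((1 : ℝ) / 25) := by
    rw [← Real.rpow_natCast, ← Real.rpow_mul (by linarith), ← Real.rpow_add (by linarith)]
    norm_num
  have hpow : (n ^ 2 / K) ^ ((1 : ℝ) / 25) ≤ 9 * (N ^ 2 / K') ^ ((1 : ℝ) / 25) := by
    calc (n ^ 2 / K) ^ ((1 : ℝ) / 25) ≤ (9 * (N ^ 2 / K')) ^ ((1 : ℝ) / 25) := by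
          refine Real.rpow_le_rpow (by positivity) ?_ (by norm_num)
          calc n ^ 2 / K ≤ (3 * N) ^ 2 / K' := by gcongr
            _ = 9 * (N ^ 2 / K') := by ring
      _ = 9 ^ ((1 : ℝ) / 25) * (N ^ 2 / K') ^ ((1 : ℝ) / 25) :=
          Real.mul_rpow (by norm_num) (by positivity)
      _ ≤ 9 * (N ^ 2 / K') ^ ((1 : ℝ) / 25) := by
          gcongr
          exact Real.rpow_le_self_of_one_le (by norm_num) (by norm_num)
  have hmain : n ^ 2 * (n ^ 2 / K) ^ ((1 : ℝ) / 25) ≤ 82944 * Q * Real.logb 2 n := by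
    calc n ^ 2 * (n ^ 2 / K) ^ ((1 : ℝ) / 25)
        ≤ (3 * N) ^ 2 * (9 * (N ^ 2 / K') ^ ((1 : ℝ) / 25)) := by gcongr
      _ = 81 * (N ^ 2 * (N ^ 2 / K') ^ ((1 : ℝ) / 25)) := by ring
      _ ≤ 81 * (512 * Q' * (1 + Real.log N)) := by gcongr
      _ ≤ 81 * (512 * Q * (Real.logb 2 n + Real.logb 2 n)) := by
          have := Real.log_nonneg hN
          have := hQ0.trans hQ
          gcongr
      _ = 82944 * Q * Real.logb 2 n := by ring
  rw [Real.div_rpow (by positivity) hK0.le, mul_div_assoc', ← hsplit,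
    div_le_iff₀ (by positivity)] at hmain
  rw [ge_iff_le, div_le_iff₀ (by positivity)]
  linarith
end

section
/- For every constant C > 0 there exists a constant c > 0 such that for every finite set A of real numbers with |A| ≥ 2: if |(A+A)/(A+A)| ≤ C·|A|², then |A:A| ≥ c · |A|² / (log₂|A|)^25. -/
open scoped Classical

/-! ### Incidences between a Cartesian product and a family of Möbius curves -/

/-- The index of the block containing `x` when `X` is cut, in increasing order, into blocks of
`m` consecutive elements. -/
noncomputable def blockIndex (X : Finset ℝ) (m : ℕ) (x : ℝ) : ℕ :=
  (X.filter (· < x)).card / m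

lemma blockIndex_monotone (X : Finset ℝ) (m : ℕ) : Monotone (blockIndex X m) := by
  intro x y hxy
  refine Nat.div_le_div_right (Finset.card_le_card ?_)
  intro z hz
  simp only [Finset.mem_filter] at hz ⊢
  exact ⟨hz.1, hz.2.trans_le hxy⟩

lemma blockIndex_lt (X : Finset ℝ) (m : ℕ) (x : ℝ) :
    blockIndex X m x < X.card / m + 1 :=
  Nat.lt_succ_of_le (Nat.div_le_div_right (Finset.card_filter_le _ _))

lemma card_blockIndex_fiber_le (X : Finset ℝ) {m : ℕ} (hm : 0 < m) (j : ℕ) :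
    (X.filter fun x => blockIndex X m x = j).card ≤ m := by
  have key : (X.filter fun x => blockIndex X m x = j).card ≤
      (Finset.Ico (j * m) (j * m + m)).card := by
    refine Finset.card_le_card_of_injOn (fun x => (X.filter (· < x)).card) ?_ ?_
    · intro x hx
      rw [Finset.mem_coe, Finset.mem_filter, blockIndex] at hx
      simp only [Finset.coe_Ico, Set.mem_Ico]
      have h1 := Nat.div_mul_le_self (X.filter (· < x)).card m
      have h2 := Nat.lt_div_mul_add (a := (X.filter (· < x)).card) hm
      rw [hx.2] at h1 h2
      exact ⟨h1, h2⟩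
    · have hlt : ∀ x ∈ X, ∀ y, x < y → (X.filter (· < x)).card < (X.filter (· < y)).card := by
        intro x hx y hxy
        refine Finset.card_lt_card ⟨fun z hz => ?_, fun h => ?_⟩
        · simp only [Finset.mem_filter] at hz ⊢
          exact ⟨hz.1, hz.2.trans hxy⟩
        · have := h (Finset.mem_filter.2 ⟨hx, hxy⟩)
          simp at this
      intro x hx y hy hxy
      simp only [Finset.coe_filter, Set.mem_ofPred_eq] at hx hy
      rcases lt_trichotomy x y with h | h | h
      · exact absurd hxy (hlt x hx.1 y h).ne
      · exact h
      · exact absurd hxy (hlt y hy.1 x h).ne'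
  simpa using key

lemma card_image_prodMap_le_of_chain {I : Finset (ℝ × ℝ)} {u v : ℝ → ℕ} (hu : Monotone u)
    (hv : Monotone v) {k : ℕ} (huk : ∀ x, u x < k) (hvk : ∀ x, v x < k)
    (hI : ∀ x ∈ I, ∀ y ∈ I, x.1 < y.1 → x.2 < y.2)
    (hI' : ∀ x ∈ I, ∀ y ∈ I, x.1 = y.1 → x = y) :
    (I.image fun x => (u x.1, v x.2)).card ≤ 2 * k := by
  have key : (I.image fun x => (u x.1, v x.2)).card ≤ (Finset.range (2 * k)).card := by
    refine Finset.card_le_card_of_injOn (fun c => c.1 + c.2) ?_ ?_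
    · intro c hc
      simp only [Finset.coe_image, Set.mem_image] at hc
      obtain ⟨x, -, rfl⟩ := hc
      have := huk x.1
      have := hvk x.2
      simp only [Finset.coe_range, Set.mem_Iio]
      omega
    · intro c hc d hd hcd
      simp only [Finset.coe_image, Set.mem_image, Finset.mem_coe] at hc hd
      obtain ⟨x, hx, rfl⟩ := hc
      obtain ⟨y, hy, rfl⟩ := hd
      simp only at hcd
      rcases lt_trichotomy x.1 y.1 with h | h | h
      · have h1 := hu h.le
        have h2 := hv (hI x hx y hy h).le
        ext <;> simp only <;> omega
      · rw [hI' x hx y hy h]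
      · have h1 := hu h.le
        have h2 := hv (hI y hy x hx h).le
        ext <;> simp only <;> omega
  simpa using key

lemma card_le_card_image_add_card_collisions {α β : Type*} [DecidableEq α]
    [DecidableEq β] (I : Finset α) (f : α → β) :
    I.card ≤ (I.image f).card + (I.offDiag.filter fun z => f z.1 = f z.2).card := by
  induction I using Finset.induction_on with
  | empty => simp
  | insert x I hx ih =>
    have hsub : (I.offDiag.filter fun z => f z.1 = f z.2) ⊆
        ((insert x I).offDiag.filter fun z => f z.1 = f z.2) :=
      Finset.filter_subset_filter _ (Finset.offDiag_mono (Finset.subset_insert x I))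
    rw [Finset.card_insert_of_notMem hx, Finset.image_insert]
    by_cases hfx : f x ∈ I.image f
    · rw [Finset.insert_eq_of_mem hfx]
      obtain ⟨y, hy, hyx⟩ := Finset.mem_image.1 hfx
      have hlt : (I.offDiag.filter fun z => f z.1 = f z.2).card <
          ((insert x I).offDiag.filter fun z => f z.1 = f z.2).card := by
        refine Finset.card_lt_card ⟨hsub, fun h => ?_⟩
        have hmem : (x, y) ∈ (insert x I).offDiag.filter fun z => f z.1 = f z.2 := by
          simp only [Finset.mem_filter, Finset.mem_offDiag]
          refine ⟨⟨Finset.mem_insert_self x I, Finset.mem_insert_of_mem hy, ?_⟩, hyx.symm⟩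
          rintro rfl
          exact hx hy
        have := h hmem
        simp only [Finset.mem_filter, Finset.mem_offDiag] at this
        exact hx this.1.1
      omega
    · rw [Finset.card_insert_of_notMem hfx]
      have := Finset.card_le_card hsub
      omega

lemma card_roots_quadratic_le_two (X : Finset ℝ) {c₂ c₁ c₀ : ℝ} (h : c₂ ≠ 0 ∨ c₀ ≠ 0) :
    (X.filter fun x => c₂ * x ^ 2 + c₁ * x + c₀ = 0).card ≤ 2 := by
  by_contra! hcard
  obtain ⟨x, hx, y, hy, z, hz, hxy, hxz, hyz⟩ := Finset.two_lt_card.1 hcard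
  simp only [Finset.mem_filter] at hx hy hz
  have h1 : (x - y) * (c₂ * (x + y) + c₁) = 0 := by linear_combination hx.2 - hy.2
  have h2 : (x - z) * (c₂ * (x + z) + c₁) = 0 := by linear_combination hx.2 - hz.2
  have h1' := (mul_eq_zero.1 h1).resolve_left (sub_ne_zero.2 hxy)
  have h2' := (mul_eq_zero.1 h2).resolve_left (sub_ne_zero.2 hxz)
  have h3 : (y - z) * c₂ = 0 := by linear_combination h1' - h2'
  have hc₂ := (mul_eq_zero.1 h3).resolve_left (sub_ne_zero.2 hyz)
  have hc₁ : c₁ = 0 := by simpa [hc₂] using h1'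
  have hc₀ : c₀ = 0 := by simpa [hc₂, hc₁] using hx.2
  exact h.elim (fun h => h hc₂) (fun h => h hc₀)

/-- The point `(x, x')` lies on the curve with parameters `(y, y')` in the family attached to the
bilinear form with coefficients `p, q, r, s`. -/
def OnCurve (p q r s : ℝ) (P c : ℝ × ℝ) : Prop :=
  p * P.1 * P.2 + q * P.1 * c.2 + r * c.1 * P.2 + s * c.1 * c.2 = 0

section Curve

variable {p q r s : ℝ}

lemma not_both_zero_of_det_pos (hdet : 0 < p * s - q * r) {x y : ℝ} (hx : 0 < x)
    (h₁ : p * x + r * y = 0) (h₂ : q * x + s * y = 0) : False := by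
  have : (p * s - q * r) * x = 0 := by linear_combination s * h₁ - r * h₂
  rcases mul_eq_zero.1 this with h | h <;> linarith

lemma OnCurve.denom_ne_zero (hdet : 0 < p * s - q * r) {P c : ℝ × ℝ} (hP : 0 < P.1)
    (hc : 0 < c.2) (h : OnCurve p q r s P c) : p * P.1 + r * c.1 ≠ 0 := by
  intro h0
  have h1 : c.2 * (q * P.1 + s * c.1) = 0 := by
    unfold OnCurve at h
    linear_combination h - P.2 * h0
  exact not_both_zero_of_det_pos hdet hP h0 ((mul_eq_zero.1 h1).resolve_left hc.ne')

lemma OnCurve.numer_ne_zero (hdet : 0 < p * s - q * r) {P c : ℝ × ℝ} (hP : 0 < P.1)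
    (hP' : 0 < P.2) (h : OnCurve p q r s P c) : q * P.1 + s * c.1 ≠ 0 := by
  intro h0
  have h1 : P.2 * (p * P.1 + r * c.1) = 0 := by
    unfold OnCurve at h
    linear_combination h - c.2 * h0
  exact not_both_zero_of_det_pos hdet hP ((mul_eq_zero.1 h1).resolve_left hP'.ne') h0

lemma OnCurve.point_snd_unique (hdet : 0 < p * s - q * r) {P Q c : ℝ × ℝ} (hP : 0 < P.1)
    (hc : 0 < c.2) (hPc : OnCurve p q r s P c) (hQc : OnCurve p q r s Q c) (h : P.1 = Q.1) :
    P = Q := by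
  have h1 : (p * P.1 + r * c.1) * (P.2 - Q.2) = 0 := by
    unfold OnCurve at hPc hQc
    rw [← h] at hQc
    linear_combination hPc - hQc
  have h2 := (mul_eq_zero.1 h1).resolve_left (hPc.denom_ne_zero hdet hP hc)
  exact Prod.ext h (sub_eq_zero.1 h2)

lemma OnCurve.param_snd_unique (hdet : 0 < p * s - q * r) {P c d : ℝ × ℝ} (hP : 0 < P.1)
    (hP' : 0 < P.2) (hc : OnCurve p q r s P c) (hd : OnCurve p q r s P d) (h : c.1 = d.1) :
    c = d := by
  have h1 : (q * P.1 + s * c.1) * (c.2 - d.2) = 0 := by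
    unfold OnCurve at hc hd
    rw [← h] at hd
    linear_combination hc - hd
  have h2 := (mul_eq_zero.1 h1).resolve_left (hc.numer_ne_zero hdet hP hP')
  exact Prod.ext h (sub_eq_zero.1 h2)

lemma OnCurve.point_fst_unique (hdet : 0 < p * s - q * r) {P Q c : ℝ × ℝ} (hP : 0 < P.2)
    (hc : 0 < c.1) (hPc : OnCurve p q r s P c) (hQc : OnCurve p q r s Q c) (h : P.2 = Q.2) :
    P = Q := by
  have hP' : OnCurve p r q s P.swap c.swap := by
    unfold OnCurve at hPc ⊢; simp only [Prod.fst_swap, Prod.snd_swap]; linear_combination hPc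
  have hQ' : OnCurve p r q s Q.swap c.swap := by
    unfold OnCurve at hQc ⊢; simp only [Prod.fst_swap, Prod.snd_swap]; linear_combination hQc
  exact Prod.swap_injective
    (OnCurve.point_snd_unique (by linarith) (by simpa using hP) (by simpa using hc) hP' hQ'
      (by simpa using h))

lemma OnCurve.snd_lt_snd (hdet : 0 < p * s - q * r) {P Q c : ℝ × ℝ} (hc : 0 < c.1)
    (hc' : 0 < c.2) (hPc : OnCurve p q r s P c) (hQc : OnCurve p q r s Q c)
    (hside : 0 < (p * P.1 + r * c.1) * (p * Q.1 + r * c.1)) (h : P.1 < Q.1) : P.2 < Q.2 := by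
  have h1 : (p * P.1 + r * c.1) * (p * Q.1 + r * c.1) * (Q.2 - P.2) =
      c.1 * c.2 * (Q.1 - P.1) * (p * s - q * r) := by
    unfold OnCurve at hPc hQc
    linear_combination (p * P.1 + r * c.1) * hQc - (p * Q.1 + r * c.1) * hPc
  have h2 : 0 < c.1 * c.2 * (Q.1 - P.1) * (p * s - q * r) := by
    have := sub_pos.2 h
    positivity
  rw [← h1] at h2
  exact sub_pos.1 ((pos_iff_pos_of_mul_pos h2).1 hside)

/-- A curve of the family meets few cells of a grid. -/
lemma card_image_curve_le (hdet : 0 < p * s - q * r) {c : ℝ × ℝ} (hc : 0 < c.1) (hc' : 0 < c.2)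
    {I : Finset (ℝ × ℝ)} (hpos : ∀ P ∈ I, 0 < P.1) (hI : ∀ P ∈ I, OnCurve p q r s P c)
    {u v : ℝ → ℕ} (hu : Monotone u) (hv : Monotone v) {k : ℕ} (huk : ∀ x, u x < k)
    (hvk : ∀ x, v x < k) : (I.image fun x => (u x.1, v x.2)).card ≤ 4 * k := by
  have hsplit : I = (I.filter fun P => 0 < p * P.1 + r * c.1) ∪
      (I.filter fun P => p * P.1 + r * c.1 < 0) := by
    ext P
    simp only [Finset.mem_union, Finset.mem_filter, ← and_or_left]
    refine ⟨fun hP => ⟨hP, ?_⟩, fun hP => hP.1⟩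
    exact ((hI P hP).denom_ne_zero hdet (hpos P hP) hc').lt_or_gt.symm
  rw [hsplit, Finset.image_union]
  refine (Finset.card_union_le _ _).trans ?_
  have h1 := card_image_prodMap_le_of_chain (I := I.filter fun P => 0 < p * P.1 + r * c.1)
    hu hv huk hvk ?_ ?_
  have h2 := card_image_prodMap_le_of_chain (I := I.filter fun P => p * P.1 + r * c.1 < 0)
    hu hv huk hvk ?_ ?_
  · omega
  · intro P hP Q hQ h
    rw [Finset.mem_filter] at hP hQ
    exact (hI P hP.1).snd_lt_snd hdet hc hc' (hI Q hQ.1) (mul_pos_of_neg_of_neg hP.2 hQ.2) h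
  · intro P hP Q hQ h
    rw [Finset.mem_filter] at hP hQ
    exact (hI P hP.1).point_snd_unique hdet (hpos P hP.1) hc' (hI Q hQ.1) h
  · intro P hP Q hQ h
    rw [Finset.mem_filter] at hP hQ
    exact (hI P hP.1).snd_lt_snd hdet hc hc' (hI Q hQ.1) (mul_pos hP.2 hQ.2) h
  · intro P hP Q hQ h
    rw [Finset.mem_filter] at hP hQ
    exact (hI P hP.1).point_snd_unique hdet (hpos P hP.1) hc' (hI Q hQ.1) h

/-- Two distinct points lie on at most two common curves of the family. -/
lemma card_common_curves_le_two (hdet : 0 < p * s - q * r) (hps : ¬ (p = 0 ∧ s = 0))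
    (hqr : ¬ (q = 0 ∧ r = 0)) {P Q : ℝ × ℝ} (hPQ : P ≠ Q) (hP : 0 < P.1) (hP' : 0 < P.2)
    (hQ : 0 < Q.1) {Y : Finset (ℝ × ℝ)} (hY : ∀ c ∈ Y, 0 < c.1 ∧ 0 < c.2) :
    (Y.filter fun c => OnCurve p q r s P c ∧ OnCurve p q r s Q c).card ≤ 2 := by
  rcases (Y.filter fun c => OnCurve p q r s P c ∧ OnCurve p q r s Q c).eq_empty_or_nonempty
    with h0 | ⟨c₀, hc₀⟩
  · simp [h0]
  rw [Finset.mem_filter] at hc₀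
  have hne : P.2 - Q.2 ≠ 0 := fun h => hPQ
    (hc₀.2.1.point_fst_unique hdet hP' (hY c₀ hc₀.1).1 hc₀.2.2 (sub_eq_zero.1 h))
  have hcoef : r * s * (P.2 - Q.2) ≠ 0 ∨ p * q * P.1 * Q.1 * (P.2 - Q.2) ≠ 0 := by
    by_contra! h
    have hrs : r * s = 0 := (mul_eq_zero.1 h.1).resolve_right hne
    have hpq : p * q = 0 := by
      have h1 := (mul_eq_zero.1 h.2).resolve_right hne
      have h2 := (mul_eq_zero.1 h1).resolve_right hQ.ne'
      exact (mul_eq_zero.1 h2).resolve_right hP.ne'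
    rcases mul_eq_zero.1 hrs with hr | hs <;> rcases mul_eq_zero.1 hpq with hp | hq
    · simp [hr, hp] at hdet
    · exact hqr ⟨hq, hr⟩
    · exact hps ⟨hp, hs⟩
    · simp [hs, hq] at hdet
  refine le_trans ?_ (card_roots_quadratic_le_two (Y.image Prod.fst)
    (c₁ := P.2 * (p * s * P.1 + q * r * Q.1) - Q.2 * (p * s * Q.1 + q * r * P.1)) hcoef)
  refine Finset.card_le_card_of_injOn Prod.fst ?_ ?_
  · intro c hc
    simp only [Finset.coe_filter, Set.mem_ofPred_eq] at hc ⊢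
    refine ⟨Finset.mem_image_of_mem _ hc.1, ?_⟩
    obtain ⟨-, h1, h2⟩ := hc
    unfold OnCurve at h1 h2
    linear_combination (q * Q.1 + s * c.1) * h1 - (q * P.1 + s * c.1) * h2
  · intro c hc d hd hcd
    simp only [Finset.coe_filter, Set.mem_ofPred_eq] at hc hd
    exact hc.2.1.param_snd_unique hdet hP hP' hd.2.1 hcd

/-- Incidence bound between a Cartesian product and the curves of the family. -/
lemma card_incidences_le (hdet : 0 < p * s - q * r) (hps : ¬ (p = 0 ∧ s = 0))
    (hqr : ¬ (q = 0 ∧ r = 0)) {X X' Y Y' : Finset ℝ} {t m : ℕ} (hm : 0 < m)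
    (hX : ∀ x ∈ X, 0 < x) (hX' : ∀ x ∈ X', 0 < x) (hY : ∀ x ∈ Y, 0 < x) (hY' : ∀ x ∈ Y', 0 < x)
    (cX : X.card = t) (cX' : X'.card = t) (cY : Y.card = t) (cY' : Y'.card = t) :
    (((X ×ˢ X') ×ˢ (Y ×ˢ Y')).filter fun z => OnCurve p q r s z.1 z.2).card ≤
      4 * (t / m + 1) * t ^ 2 + 2 * (t ^ 2 * m ^ 2) := by
  set f : ℝ × ℝ → ℕ × ℕ := fun x => (blockIndex X m x.1, blockIndex X' m x.2) with hf
  set D := (X ×ˢ X').offDiag.filter fun z => f z.1 = f z.2 with hD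
  have hDcard : D.card ≤ t ^ 2 * m ^ 2 := by
    have h1 : D ⊆ ((X ×ˢ X') ×ˢ (X ×ˢ X')).filter fun z => f z.1 = f z.2 := by
      refine Finset.filter_subset_filter _ ?_
      intro z hz
      rw [Finset.mem_offDiag] at hz
      exact Finset.mem_product.2 ⟨hz.1, hz.2.1⟩
    refine (Finset.card_le_card h1).trans ?_
    rw [Finset.card_filter, Finset.sum_product]
    have h2 : ∀ P ∈ X ×ˢ X', (∑ Q ∈ X ×ˢ X', if f P = f Q then 1 else 0) ≤ m ^ 2 := by
      intro P _
      rw [← Finset.card_filter]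
      have h3 : ((X ×ˢ X').filter fun Q => f P = f Q) ⊆
          (X.filter fun x => blockIndex X m x = blockIndex X m P.1) ×ˢ
          (X'.filter fun x => blockIndex X' m x = blockIndex X' m P.2) := by
        intro Q hQ
        simp only [hf, Finset.mem_filter, Finset.mem_product, Prod.mk.injEq] at hQ ⊢
        exact ⟨⟨hQ.1.1, hQ.2.1.symm⟩, hQ.1.2, hQ.2.2.symm⟩
      refine (Finset.card_le_card h3).trans ?_
      rw [Finset.card_product, sq]
      exact Nat.mul_le_mul (card_blockIndex_fiber_le X hm _) (card_blockIndex_fiber_le X' hm _)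
    refine (Finset.sum_le_sum h2).trans ?_
    simp [cX, cX', sq]
  have hcurve : ∀ c ∈ Y ×ˢ Y',
      ((X ×ˢ X').filter fun P => OnCurve p q r s P c).card ≤ 4 * (t / m + 1) +
        (D.filter fun z => OnCurve p q r s z.1 c ∧ OnCurve p q r s z.2 c).card := by
    intro c hc
    rw [Finset.mem_product] at hc
    refine (card_le_card_image_add_card_collisions _ f).trans (add_le_add ?_ ?_)
    · refine card_image_curve_le hdet (hY _ hc.1) (hY' _ hc.2) ?_ ?_ (blockIndex_monotone X m)
        (blockIndex_monotone X' m) (fun x => ?_) (fun x => ?_)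
      · intro P hP
        rw [Finset.mem_filter, Finset.mem_product] at hP
        exact hX _ hP.1.1
      · intro P hP
        exact (Finset.mem_filter.1 hP).2
      · exact cX ▸ blockIndex_lt X m x
      · exact cX' ▸ blockIndex_lt X' m x
    · refine Finset.card_le_card ?_
      intro z hz
      simp only [hD, Finset.mem_filter, Finset.mem_offDiag] at hz ⊢
      tauto
  calc (((X ×ˢ X') ×ˢ (Y ×ˢ Y')).filter fun z => OnCurve p q r s z.1 z.2).card
      = ∑ c ∈ Y ×ˢ Y', ((X ×ˢ X').filter fun P => OnCurve p q r s P c).card := by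
        simp only [Finset.card_filter]
        rw [Finset.sum_product_right]
    _ ≤ ∑ c ∈ Y ×ˢ Y', (4 * (t / m + 1) +
          (D.filter fun z => OnCurve p q r s z.1 c ∧ OnCurve p q r s z.2 c).card) :=
        Finset.sum_le_sum hcurve
    _ = 4 * (t / m + 1) * t ^ 2 + ∑ z ∈ D,
          ((Y ×ˢ Y').filter fun c => OnCurve p q r s z.1 c ∧ OnCurve p q r s z.2 c).card := by
        rw [Finset.sum_add_distrib]
        congr 1
        · simp [cY, cY', sq, mul_comm]
        · simp only [Finset.card_filter]
          rw [Finset.sum_comm]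
    _ ≤ 4 * (t / m + 1) * t ^ 2 + ∑ z ∈ D, 2 := by
        refine Nat.add_le_add_left (Finset.sum_le_sum fun z hz => ?_) _
        simp only [hD, Finset.mem_filter, Finset.mem_offDiag, Finset.mem_product] at hz
        refine card_common_curves_le_two hdet hps hqr hz.1.2.2 (hX _ hz.1.1.1) (hX' _ hz.1.1.2)
          (hX _ hz.1.2.1.1) (fun c hc => ?_)
        rw [Finset.mem_product] at hc
        exact ⟨hY _ hc.1, hY' _ hc.2⟩
    _ ≤ 4 * (t / m + 1) * t ^ 2 + 2 * (t ^ 2 * m ^ 2) := by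
        rw [Finset.sum_const, smul_eq_mul, mul_comm D.card]
        gcongr

lemma card_incidences_le_cube (hdet : 0 < p * s - q * r) {X X' Y Y' : Finset ℝ} {t : ℕ}
    (hX : ∀ x ∈ X, 0 < x) (hX' : ∀ x ∈ X', 0 < x)
    (cX : X.card = t) (cX' : X'.card = t) (cY : Y.card = t) :
    (((X ×ˢ X') ×ˢ (Y ×ˢ Y')).filter fun z => OnCurve p q r s z.1 z.2).card ≤ t ^ 3 := by
  have h : t ^ 3 = ((X ×ˢ X') ×ˢ Y).card := by simp [cX, cX', cY]; ring
  rw [h]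
  refine Finset.card_le_card_of_injOn (fun z => (z.1, z.2.1)) ?_ ?_
  · intro z hz
    simp only [Finset.coe_filter, Set.mem_ofPred_eq, Finset.mem_product] at hz
    simp only [Finset.mem_coe, Finset.mem_product]
    tauto
  · intro z hz w hw hzw
    simp only [Finset.coe_filter, Set.mem_ofPred_eq, Finset.mem_product, Prod.mk.injEq]
      at hz hw hzw
    have hw2 := hw.2
    rw [← hzw.1] at hw2
    exact Prod.ext hzw.1 (hz.2.param_snd_unique hdet (hX _ hz.1.1.1) (hX' _ hz.1.1.2) hw2 hzw.2)

end Curve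

/-! ### Slopes determined by a cluster of lines through the origin -/

lemma card_sq_le_card_image_mul_card_collisions {α β : Type*} [DecidableEq β] (Z : Finset α)
    (f : α → β) :
    Z.card ^ 2 ≤ (Z.image f).card * ((Z ×ˢ Z).filter fun z => f z.1 = f z.2).card := by
  have h1 : Z.card = ∑ y ∈ Z.image f, (Z.filter fun z => f z = y).card :=
    Finset.card_eq_sum_card_image f Z
  have h2 : ((Z ×ˢ Z).filter fun z => f z.1 = f z.2).card =
      ∑ y ∈ Z.image f, (Z.filter fun z => f z = y).card ^ 2 := by
    rw [Finset.card_eq_sum_card_fiberwise (f := fun z => f z.1) (t := Z.image f)]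
    · refine Finset.sum_congr rfl fun y _ => ?_
      rw [sq, ← Finset.card_product]
      congr 1
      ext z
      simp only [Finset.mem_filter, Finset.mem_product]
      constructor
      · rintro ⟨⟨⟨h1, h2⟩, h3⟩, h4⟩
        exact ⟨⟨h1, h4⟩, h2, h3 ▸ h4⟩
      · rintro ⟨⟨h1, h4⟩, h2, h3⟩
        exact ⟨⟨⟨h1, h2⟩, h4.trans h3.symm⟩, h4⟩
    · intro z hz
      rw [Finset.mem_coe, Finset.mem_filter, Finset.mem_product] at hz
      exact Finset.mem_coe.2 (Finset.mem_image_of_mem f hz.1.1)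
  rw [h2]
  nth_rewrite 1 [h1]
  exact sq_sum_le_card_mul_sum_sq

lemma two_mul_card_offDiag_filter_lt (Q : Finset ℝ) :
    2 * (Q.offDiag.filter fun e => e.1 < e.2).card = Q.card * Q.card - Q.card := by
  have h1 : (Q.offDiag.filter fun e => e.1 < e.2).card =
      (Q.offDiag.filter fun e => ¬ e.1 < e.2).card := by
    refine Finset.card_bij' (fun e _ => e.swap) (fun e _ => e.swap) ?_ ?_ (by simp) (by simp)
    · intro e he
      simp only [Finset.mem_filter, Finset.mem_offDiag, Prod.fst_swap, Prod.snd_swap] at he ⊢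
      exact ⟨⟨he.1.2.1, he.1.1, he.1.2.2.symm⟩, he.2.le.not_gt⟩
    · intro e he
      simp only [Finset.mem_filter, Finset.mem_offDiag, Prod.fst_swap, Prod.snd_swap] at he ⊢
      exact ⟨⟨he.1.2.1, he.1.1, he.1.2.2.symm⟩,
        lt_of_le_of_ne (not_lt.1 he.2) he.1.2.2.symm⟩
  rw [← Finset.offDiag_card,
    ← Finset.card_filter_add_card_filter_not (s := Q.offDiag) (fun e : ℝ × ℝ => e.1 < e.2),
    ← h1, two_mul]

/-- The slope of the sum of the points of abscissae `z.2.1` and `z.2.2` on the lines through the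
origin of slopes `z.1.1` and `z.1.2`. -/
noncomputable def sumSlope (z : (ℝ × ℝ) × (ℝ × ℝ)) : ℝ :=
  (z.2.1 * z.1.1 + z.2.2 * z.1.2) / (z.2.1 + z.2.2)

lemma onCurve_of_sumSlope_eq {e e' x x' : ℝ × ℝ} (hx : 0 < x.1 + x.2) (hx' : 0 < x'.1 + x'.2)
    (h : sumSlope (e, x) = sumSlope (e', x')) :
    OnCurve (e.1 - e'.1) (e.1 - e'.2) (e.2 - e'.1) (e.2 - e'.2) (x.1, x'.1) (x.2, x'.2) := by
  unfold sumSlope at h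
  rw [div_eq_div_iff hx.ne' hx'.ne'] at h
  unfold OnCurve
  linear_combination h

/-- Many slopes of sums of points of `A ×ˢ A` lie strictly inside a cluster of rich lines. -/
lemma mul_le_card_quotSumSet_filter {A Q : Finset ℝ} (hA : ∀ a ∈ A, 0 < a) {t M : ℕ} (hM : 2 ≤ M)
    (hMt : M ^ 6 ≤ t) (hQ : Q.card = M) {B : ℝ → Finset ℝ} (hBA : ∀ l ∈ Q, B l ⊆ A)
    (hB : ∀ l ∈ Q, (B l).card = t) (hBl : ∀ l ∈ Q, ∀ a ∈ B l, a * l ∈ A) {lo hi : ℝ}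
    (hlo : ∀ l ∈ Q, lo ≤ l) (hhi : ∀ l ∈ Q, l ≤ hi) :
    M ^ 2 * t ≤ 44 * ((quotSumSet A).filter fun x => lo < x ∧ x < hi).card := by
  set P := Q.offDiag.filter fun e => e.1 < e.2 with hP
  have hPmem : ∀ e ∈ P, e.1 ∈ Q ∧ e.2 ∈ Q ∧ e.1 < e.2 := by
    intro e he
    simp only [hP, Finset.mem_filter, Finset.mem_offDiag] at he
    exact ⟨he.1.1, he.1.2.1, he.2⟩
  have hPcard : 2 * P.card = M * M - M := by
    rw [hP, two_mul_card_offDiag_filter_lt, hQ]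
  have hPle : P.card ≤ M ^ 2 := by rw [sq]; omega
  have hPge : M ^ 2 ≤ 4 * P.card := by
    have : 2 * M ≤ M * M := Nat.mul_le_mul_right M hM
    rw [sq]; omega
  have hMpos : 0 < M ^ 2 := by positivity
  have htpos : 0 < t := lt_of_lt_of_le (by positivity) hMt
  set Z := (P ×ˢ (A ×ˢ A)).filter fun z => z.2.1 ∈ B z.1.1 ∧ z.2.2 ∈ B z.1.2 with hZ
  have hZmem : ∀ z ∈ Z, z.1 ∈ P ∧ z.2.1 ∈ B z.1.1 ∧ z.2.2 ∈ B z.1.2 := by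
    intro z hz
    simp only [hZ, Finset.mem_filter, Finset.mem_product] at hz
    exact ⟨hz.1.1, hz.2⟩
  have hZpos : ∀ z ∈ Z, 0 < z.2.1 ∧ 0 < z.2.2 := by
    intro z hz
    simp only [hZ, Finset.mem_filter, Finset.mem_product] at hz
    exact ⟨hA _ hz.1.2.1, hA _ hz.1.2.2⟩
  have hZcard : Z.card = P.card * t ^ 2 := by
    rw [hZ, Finset.card_filter, Finset.sum_product, ← smul_eq_mul, ← Finset.sum_const]
    refine Finset.sum_congr rfl fun e he => ?_
    obtain ⟨h1, h2, -⟩ := hPmem e he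
    rw [← Finset.card_filter]
    have : ((A ×ˢ A).filter fun x => x.1 ∈ B e.1 ∧ x.2 ∈ B e.2) = B e.1 ×ˢ B e.2 := by
      ext x
      simp only [Finset.mem_filter, Finset.mem_product]
      exact ⟨fun h => h.2, fun h => ⟨⟨hBA _ h1 h.1, hBA _ h2 h.2⟩, h⟩⟩
    rw [this, Finset.card_product, hB _ h1, hB _ h2, sq]
  have himage : Z.image sumSlope ⊆ (quotSumSet A).filter fun x => lo < x ∧ x < hi := by
    intro y hy
    obtain ⟨z, hz, rfl⟩ := Finset.mem_image.1 hy
    obtain ⟨hzP, hz1, hz2⟩ := hZmem z hz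
    obtain ⟨hz3, hz4⟩ := hZpos z hz
    obtain ⟨h1, h2, h12⟩ := hPmem _ hzP
    have hlo' := hlo _ h1
    have hhi' := hhi _ h2
    rw [Finset.mem_filter]
    refine ⟨?_, ?_, ?_⟩
    · refine Finset.mem_image.2
        ⟨((z.2.1 * z.1.1, z.2.2 * z.1.2), (z.2.1, z.2.2)), Finset.mem_filter.2 ⟨?_, ?_⟩, rfl⟩
      · simp only [Finset.mem_product]
        exact ⟨⟨hBl _ h1 _ hz1, hBl _ h2 _ hz2⟩, hBA _ h1 hz1, hBA _ h2 hz2⟩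
      · exact (add_pos hz3 hz4).ne'
    · rw [sumSlope, lt_div_iff₀ (add_pos hz3 hz4)]
      nlinarith
    · rw [sumSlope, div_lt_iff₀ (add_pos hz3 hz4)]
      nlinarith
  set E := ((Z ×ˢ Z).filter fun z => sumSlope z.1 = sumSlope z.2) with hE
  set N : (ℝ × ℝ) × (ℝ × ℝ) → ℕ := fun w =>
    (((B w.1.1 ×ˢ B w.2.1) ×ˢ (B w.1.2 ×ˢ B w.2.2)).filter fun z =>
      OnCurve (w.1.1 - w.2.1) (w.1.1 - w.2.2) (w.1.2 - w.2.1) (w.1.2 - w.2.2) z.1 z.2).card with hN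
  have hEN : E.card ≤ ∑ w ∈ P ×ˢ P, N w := by
    rw [Finset.card_eq_sum_card_fiberwise (f := fun z => (z.1.1, z.2.1)) (t := P ×ˢ P)]
    · refine Finset.sum_le_sum fun w _ => ?_
      refine Finset.card_le_card_of_injOn
        (fun z => ((z.1.2.1, z.2.2.1), (z.1.2.2, z.2.2.2))) ?_ ?_
      · intro z hz
        rw [Finset.mem_coe, Finset.mem_filter, hE, Finset.mem_filter, Finset.mem_product] at hz
        obtain ⟨⟨⟨hz1, hz2⟩, hslope⟩, rfl⟩ := hz
        rw [Finset.mem_coe, Finset.mem_filter]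
        have h1 := hZmem _ hz1
        have h2 := hZmem _ hz2
        refine ⟨?_, ?_⟩
        · simp only [Finset.mem_product]
          exact ⟨⟨h1.2.1, h2.2.1⟩, h1.2.2, h2.2.2⟩
        · exact onCurve_of_sumSlope_eq (add_pos (hZpos _ hz1).1 (hZpos _ hz1).2)
            (add_pos (hZpos _ hz2).1 (hZpos _ hz2).2) hslope
      · intro z hz z' hz' h
        rw [Finset.mem_coe, Finset.mem_filter] at hz hz'
        have h3 := hz.2.trans hz'.2.symm
        simp only [Prod.mk.injEq] at h h3
        ext <;> simp_all
    · intro z hz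
      rw [Finset.mem_coe, hE, Finset.mem_filter, Finset.mem_product] at hz
      simp only [Finset.coe_product, Set.mem_prod, Finset.mem_coe]
      exact ⟨(hZmem _ hz.1.1).1, (hZmem _ hz.1.2).1⟩
  have hNle : ∀ w ∈ P ×ˢ P, M ^ 2 * N w ≤ 10 * t ^ 3 + if w.1 = w.2 then M ^ 2 * t ^ 3 else 0 := by
    intro w hw
    rw [Finset.mem_product] at hw
    obtain ⟨h1, h2, h12⟩ := hPmem _ hw.1
    obtain ⟨h3, h4, h34⟩ := hPmem _ hw.2
    have hdet : 0 < (w.1.1 - w.2.1) * (w.1.2 - w.2.2) - (w.1.1 - w.2.2) * (w.1.2 - w.2.1) := by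
      have : (w.1.1 - w.2.1) * (w.1.2 - w.2.2) - (w.1.1 - w.2.2) * (w.1.2 - w.2.1) =
        (w.1.2 - w.1.1) * (w.2.2 - w.2.1) := by ring
      rw [this]
      exact mul_pos (sub_pos.2 h12) (sub_pos.2 h34)
    have hpos : ∀ l ∈ Q, ∀ a ∈ B l, 0 < a := fun l hl a ha => hA a (hBA l hl ha)
    split_ifs with hww
    · have := card_incidences_le_cube hdet (Y' := B w.2.2) (hpos _ h1) (hpos _ h3) (hB _ h1)
        (hB _ h3) (hB _ h2)
      exact (Nat.mul_le_mul_left _ this).trans (Nat.le_add_left _ _)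
    · have hinc := card_incidences_le hdet (m := M ^ 2) ?_ ?_ hMpos (hpos _ h1) (hpos _ h3)
        (hpos _ h2) (hpos _ h4) (hB _ h1) (hB _ h3) (hB _ h2) (hB _ h4)
      · have hdiv : t / M ^ 2 * M ^ 2 ≤ t := Nat.div_mul_le_self t (M ^ 2)
        have hM2 : M ^ 2 ≤ t := (Nat.pow_le_pow_right (by omega) (by norm_num)).trans hMt
        calc M ^ 2 * N w ≤ M ^ 2 * (4 * (t / M ^ 2 + 1) * t ^ 2 + 2 * (t ^ 2 * (M ^ 2) ^ 2)) :=
              Nat.mul_le_mul_left _ hinc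
          _ = 4 * (t / M ^ 2 * M ^ 2) * t ^ 2 + 4 * M ^ 2 * t ^ 2 + 2 * M ^ 6 * t ^ 2 := by ring
          _ ≤ 4 * t * t ^ 2 + 4 * t * t ^ 2 + 2 * t * t ^ 2 := by gcongr
          _ = 10 * t ^ 3 + 0 := by ring
      · rintro ⟨hp, hs⟩
        exact hww (Prod.ext (sub_eq_zero.1 hp) (sub_eq_zero.1 hs))
      · rintro ⟨hq, hr⟩
        linarith
  have hEle : E.card ≤ 11 * P.card * t ^ 3 := by
    refine Nat.le_of_mul_le_mul_left ?_ hMpos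
    calc M ^ 2 * E.card ≤ M ^ 2 * ∑ w ∈ P ×ˢ P, N w := Nat.mul_le_mul_left _ hEN
      _ = ∑ w ∈ P ×ˢ P, M ^ 2 * N w := Finset.mul_sum _ _ _
      _ ≤ ∑ w ∈ P ×ˢ P, (10 * t ^ 3 + if w.1 = w.2 then M ^ 2 * t ^ 3 else 0) :=
          Finset.sum_le_sum hNle
      _ = P.card * P.card * (10 * t ^ 3) + P.card * (M ^ 2 * t ^ 3) := by
          rw [Finset.sum_add_distrib, Finset.sum_const, Finset.card_product, smul_eq_mul,
            Finset.sum_product]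
          simp
      _ ≤ P.card * M ^ 2 * (10 * t ^ 3) + P.card * (M ^ 2 * t ^ 3) := by gcongr
      _ = M ^ 2 * (11 * P.card * t ^ 3) := by ring
  have hCS := card_sq_le_card_image_mul_card_collisions Z sumSlope
  have hPpos : 0 < P.card := by omega
  set R := ((quotSumSet A).filter fun x => lo < x ∧ x < hi).card with hR
  have hPt : P.card * t ≤ 11 * R := by
    refine Nat.le_of_mul_le_mul_left ?_ (by positivity : 0 < P.card * t ^ 3)
    calc P.card * t ^ 3 * (P.card * t) = Z.card ^ 2 := by rw [hZcard]; ring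
      _ ≤ (Z.image sumSlope).card * E.card := hCS
      _ ≤ R * (11 * P.card * t ^ 3) := Nat.mul_le_mul (Finset.card_le_card himage) hEle
      _ = P.card * t ^ 3 * (11 * R) := by ring
  calc M ^ 2 * t ≤ 4 * P.card * t := Nat.mul_le_mul_right t hPge
    _ = 4 * (P.card * t) := by ring
    _ ≤ 4 * (11 * R) := Nat.mul_le_mul_left 4 hPt
    _ = 44 * R := by ring

lemma exists_initial_subset_card_eq (L : Finset ℝ) (M : ℕ) (hM : M ≤ L.card) :
    ∃ Q ⊆ L, Q.card = M ∧ ∀ x ∈ Q, ∀ y ∈ L \ Q, x < y := by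
  induction M with
  | zero => exact ⟨∅, by simp⟩
  | succ M ih =>
    obtain ⟨Q, hQL, hQ, hlt⟩ := ih (by omega)
    have hne : (L \ Q).Nonempty := by
      rw [← Finset.card_pos, Finset.card_sdiff_of_subset hQL]
      omega
    set y := (L \ Q).min' hne with hy
    have hyL : y ∈ L \ Q := Finset.min'_mem _ hne
    have hyL' := Finset.mem_sdiff.1 hyL
    refine ⟨insert y Q, Finset.insert_subset hyL'.1 hQL, ?_, ?_⟩
    · rw [Finset.card_insert_of_notMem hyL'.2, hQ]
    · intro x hx z hz
      rw [Finset.mem_sdiff, Finset.mem_insert, not_or] at hz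
      have hzL : z ∈ L \ Q := Finset.mem_sdiff.2 ⟨hz.1, hz.2.2⟩
      rcases Finset.mem_insert.1 hx with rfl | hx
      · exact lt_of_le_of_ne (Finset.min'_le _ _ hzL) (Ne.symm hz.2.1)
      · exact hlt x hx z hzL

/-- If every cluster of `M` elements of `L` spans an interval containing many elements of `R`,
then splitting `L` into clusters of consecutive elements shows that `R` is large. -/
lemma mul_le_card_of_clusters {M K D : ℕ} (hM : 0 < M) (k : ℕ) (L R : Finset ℝ)
    (hk : k * M ≤ L.card)
    (h : ∀ Q ⊆ L, Q.card = M → ∀ lo hi : ℝ, (∀ l ∈ Q, lo ≤ l) → (∀ l ∈ Q, l ≤ hi) →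
      K ≤ D * (R.filter fun x => lo < x ∧ x < hi).card) :
    k * K ≤ D * R.card := by
  induction k generalizing L R with
  | zero => simp
  | succ k ih =>
    rw [add_mul, one_mul] at hk
    obtain ⟨Q, hQL, hQ, hlt⟩ := exists_initial_subset_card_eq L M (by omega)
    have hne : Q.Nonempty := Finset.card_pos.1 (hQ ▸ hM)
    set hi := Q.max' hne with hhi
    have h1 : K ≤ D * (R.filter fun x => x < hi).card := by
      refine (h Q hQL hQ (Q.min' hne) hi (fun l hl => Finset.min'_le _ _ hl)
        (fun l hl => Finset.le_max' _ _ hl)).trans (Nat.mul_le_mul_left D (Finset.card_le_card ?_))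
      exact Finset.monotone_filter_right _ fun x _ hx => hx.2
    have h2 : k * K ≤ D * (R.filter fun x => ¬ x < hi).card := by
      refine ih (L \ Q) _ ?_ ?_
      · rw [Finset.card_sdiff_of_subset hQL]
        omega
      · intro Q' hQ' hQ'M lo' hi' hlo' hhi'
        refine (h Q' (hQ'.trans Finset.sdiff_subset) hQ'M (max lo' hi) hi' ?_ hhi').trans
          (Nat.mul_le_mul_left D (Finset.card_le_card ?_))
        · intro l hl
          exact max_le (hlo' l hl) (hlt _ (Finset.max'_mem _ _) l (hQ' hl)).le
        · intro x hx
          simp only [Finset.mem_filter, max_lt_iff] at hx ⊢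
          exact ⟨⟨hx.1, hx.2.1.2.le.not_gt⟩, hx.2.1.1, hx.2.2⟩
    rw [← Finset.card_filter_add_card_filter_not (s := R) (fun x => x < hi)]
    linarith

/-! ### Rich lines -/

/-- The ratios `l` that are represented at least `t` times as a ratio of elements of `A`. -/
noncomputable def richRatios (A : Finset ℝ) (t : ℕ) : Finset ℝ :=
  (ratioSet A).filter fun l => t ≤ (A.filter fun a => a * l ∈ A).card

lemma card_richRatios_mul_le {A : Finset ℝ} (hA : ∀ a ∈ A, 0 < a) {t M : ℕ} (hM : 2 ≤ M)
    (hMt : M ^ 6 ≤ t) :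
    (richRatios A t).card * t * M ≤ A.card ^ 2 + 88 * (quotSumSet A).card := by
  set L := richRatios A t with hL
  have hrich : ∀ l ∈ L, t ≤ (A.filter fun a => a * l ∈ A).card := fun l hl =>
    (Finset.mem_filter.1 hl).2
  have hMpos : 0 < M := by omega
  rcases lt_or_ge L.card M with hlt | hge
  · rcases L.eq_empty_or_nonempty with h0 | ⟨l, hl⟩
    · simp [h0]
    · have htA : t ≤ A.card := (hrich l hl).trans (Finset.card_filter_le _ _)
      have hM2 : M ^ 2 ≤ t := (Nat.pow_le_pow_right hMpos (by norm_num)).trans hMt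
      calc L.card * t * M ≤ M * t * M := by gcongr
        _ = M ^ 2 * t := by ring
        _ ≤ A.card * A.card := Nat.mul_le_mul (hM2.trans htA) htA
        _ ≤ A.card ^ 2 + 88 * (quotSumSet A).card := by rw [sq]; exact Nat.le_add_right _ _
  · have hex : ∀ l, ∃ B : Finset ℝ, l ∈ L →
        B ⊆ (A.filter fun a => a * l ∈ A) ∧ B.card = t := by
      intro l
      by_cases hl : l ∈ L
      · obtain ⟨B, hB⟩ := Finset.exists_subset_card_eq (hrich l hl)
        exact ⟨B, fun _ => hB⟩
      · exact ⟨∅, fun h => absurd h hl⟩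
    choose B hB using hex
    have hcl := mul_le_card_of_clusters (K := M ^ 2 * t) (D := 44) hMpos (L.card / M) L
      (quotSumSet A) (Nat.div_mul_le_self _ _) (fun Q hQL hQ lo hi hlo hhi =>
        mul_le_card_quotSumSet_filter hA hM hMt hQ
          (fun l hl => (hB l (hQL hl)).1.trans (Finset.filter_subset _ _))
          (fun l hl => (hB l (hQL hl)).2)
          (fun l hl a ha => (Finset.mem_filter.1 ((hB l (hQL hl)).1 ha)).2) hlo hhi)
    have hdiv : L.card ≤ 2 * (L.card / M * M) := by
      have h1 := Nat.lt_div_mul_add (a := L.card) hMpos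
      have h2 : 1 * M ≤ L.card / M * M :=
        Nat.mul_le_mul_right M ((Nat.one_le_div_iff hMpos).2 hge)
      omega
    calc L.card * t * M ≤ 2 * (L.card / M * M) * t * M := by gcongr
      _ = 2 * (L.card / M * (M ^ 2 * t)) := by ring
      _ ≤ 2 * (44 * (quotSumSet A).card) := Nat.mul_le_mul_left 2 hcl
      _ ≤ A.card ^ 2 + 88 * (quotSumSet A).card := by rw [← mul_assoc]; exact Nat.le_add_left _ _

lemma card_sq_le_sum_card_richRatios {A : Finset ℝ} (hA : ∀ a ∈ A, 0 < a) :
    A.card ^ 2 ≤ ∑ t ∈ Finset.Icc 1 A.card, (richRatios A t).card := by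
  have h1 : A.card ^ 2 ≤ ∑ l ∈ ratioSet A, (A.filter fun a => a * l ∈ A).card := by
    rw [sq, ← Finset.card_product,
      Finset.card_eq_sum_card_fiberwise (f := fun x : ℝ × ℝ => x.2 / x.1) (t := ratioSet A)]
    · refine Finset.sum_le_sum fun l _ => Finset.card_le_card_of_injOn Prod.fst ?_ ?_
      · intro x hx
        rw [Finset.mem_coe, Finset.mem_filter, Finset.mem_product] at hx
        rw [Finset.mem_coe, Finset.mem_filter]
        refine ⟨hx.1.1, ?_⟩
        rw [← hx.2, mul_div_cancel₀ _ (hA _ hx.1.1).ne']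
        exact hx.1.2
      · intro x hx y hy hxy
        rw [Finset.mem_coe, Finset.mem_filter, Finset.mem_product] at hx hy
        have hxpos := (hA _ hx.1.1).ne'
        have hypos := (hA _ hy.1.1).ne'
        have h := hx.2.trans hy.2.symm
        rw [div_eq_div_iff hxpos hypos, hxy] at h
        exact Prod.ext hxy (mul_right_cancel₀ hypos h)
    · intro x hx
      rw [Finset.mem_coe, Finset.mem_product] at hx
      refine Finset.mem_coe.2 (Finset.mem_image.2 ⟨(x.2, x.1), Finset.mem_filter.2 ⟨?_, ?_⟩, rfl⟩)
      · exact Finset.mem_product.2 ⟨hx.2, hx.1⟩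
      · exact (hA _ hx.1).ne'
  refine h1.trans (le_of_eq ?_)
  have h2 : ∀ t, (richRatios A t).card =
      ∑ l ∈ ratioSet A, if t ≤ (A.filter fun a => a * l ∈ A).card then 1 else 0 :=
    fun t => Finset.card_filter _ _
  simp only [h2]
  rw [Finset.sum_comm]
  refine Finset.sum_congr rfl fun l _ => ?_
  rw [← Finset.card_filter]
  have hle : (A.filter fun a => a * l ∈ A).card ≤ A.card := Finset.card_filter_le _ _
  have : ((Finset.Icc 1 A.card).filter fun t => t ≤ (A.filter fun a => a * l ∈ A).card) =
      Finset.Icc 1 (A.filter fun a => a * l ∈ A).card := by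
    ext t
    simp only [Finset.mem_filter, Finset.mem_Icc]
    omega
  rw [this, Nat.card_Icc, Nat.add_sub_cancel]

lemma card_richRatios_le_rpow {A : Finset ℝ} (hA : ∀ a ∈ A, 0 < a) {C : ℝ}
    (hC : ((quotSumSet A).card : ℝ) ≤ C * (A.card : ℝ) ^ 2) {t : ℕ} (ht : 64 ≤ t) :
    ((richRatios A t).card : ℝ) ≤
      2 * (1 + 88 * C) * (A.card : ℝ) ^ 2 * (1 / (t : ℝ) ^ (7 / 6 : ℝ)) := by
  set x : ℝ := (t : ℝ) ^ (1 / 6 : ℝ) with hx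
  have ht0 : (0 : ℝ) < t := by exact_mod_cast (by omega : 0 < t)
  have hx6 : x ^ 6 = t := by
    rw [hx, ← Real.rpow_natCast, ← Real.rpow_mul ht0.le]
    norm_num
  have hx0 : 0 < x := Real.rpow_pos_of_pos ht0 _
  have hx2 : 2 ≤ x := by
    refine le_of_pow_le_pow_left₀ (n := 6) (by norm_num) hx0.le ?_
    rw [hx6]
    norm_num
    exact_mod_cast ht
  have h76 : (t : ℝ) ^ (7 / 6 : ℝ) = t * x := by
    rw [hx, ← Real.rpow_one_add' ht0.le (by norm_num)]
    norm_num
  have hM : 2 ≤ ⌊x⌋₊ := Nat.le_floor (by exact_mod_cast hx2)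
  have hMt : ⌊x⌋₊ ^ 6 ≤ t := by
    have : ((⌊x⌋₊ : ℕ) : ℝ) ^ 6 ≤ (t : ℝ) := by
      rw [← hx6]
      exact pow_le_pow_left₀ (Nat.cast_nonneg _) (Nat.floor_le hx0.le) 6
    exact_mod_cast this
  have hxM : x ≤ 2 * (⌊x⌋₊ : ℝ) := by
    have h1 := Nat.lt_floor_add_one x
    have h2 : (2 : ℝ) ≤ (⌊x⌋₊ : ℝ) := by exact_mod_cast hM
    linarith
  have hmain : ((richRatios A t).card : ℝ) * t * (⌊x⌋₊ : ℝ) ≤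
      (A.card : ℝ) ^ 2 + 88 * ((quotSumSet A).card : ℝ) := by
    exact_mod_cast card_richRatios_mul_le hA hM hMt
  rw [h76, mul_one_div, le_div_iff₀ (by positivity)]
  have hnn : (0 : ℝ) ≤ ((richRatios A t).card : ℝ) * t := by positivity
  nlinarith [mul_le_mul_of_nonneg_left hxM hnn]

/-- The logarithm-free bound for sets of positive reals. -/
lemma exists_mul_card_sq_le_card_ratioSet_of_pos {C : ℝ} (hC : 0 < C) :
    ∃ c : ℝ, 0 < c ∧ ∀ A : Finset ℝ, (∀ a ∈ A, 0 < a) →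
      ((quotSumSet A).card : ℝ) ≤ C * (A.card : ℝ) ^ 2 →
      c * (A.card : ℝ) ^ 2 ≤ ((ratioSet A).card : ℝ) := by
  have hsum : Summable fun t : ℕ => 1 / (t : ℝ) ^ (7 / 6 : ℝ) :=
    Real.summable_one_div_nat_rpow.2 (by norm_num)
  obtain ⟨s, hs⟩ := summable_iff_vanishing_norm.1 hsum (1 / (4 * (1 + 88 * C))) (by positivity)
  set t₀ := max 64 (s.sup id) with ht₀
  have ht₀pos : (0 : ℝ) < t₀ := by
    exact_mod_cast (lt_of_lt_of_le (by norm_num) (le_max_left 64 (s.sup id)) : 0 < t₀)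
  refine ⟨1 / (2 * t₀), by positivity, fun A hA hAC => ?_⟩
  set n : ℝ := (A.card : ℝ) with hn
  set W := (Finset.Icc 1 A.card).filter fun t => ¬ t ≤ t₀ with hW
  have htail : ∑ t ∈ W, ((richRatios A t).card : ℝ) ≤ n ^ 2 / 2 := by
    have h1 : ∑ t ∈ W, ((richRatios A t).card : ℝ) ≤
        2 * (1 + 88 * C) * n ^ 2 * ∑ t ∈ W, 1 / (t : ℝ) ^ (7 / 6 : ℝ) := by
      rw [Finset.mul_sum]
      refine Finset.sum_le_sum fun t ht => card_richRatios_le_rpow hA hAC ?_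
      have h2 := (Finset.mem_filter.1 ht).2
      have h3 := le_max_left 64 (s.sup id)
      omega
    have hdisj : Disjoint W s := by
      refine Finset.disjoint_left.2 fun t ht hts => (Finset.mem_filter.1 ht).2 ?_
      exact (Finset.le_sup (f := id) hts).trans (le_max_right _ _)
    have h2 := (le_abs_self _).trans (hs W hdisj).le
    refine h1.trans ((mul_le_mul_of_nonneg_left h2 (by positivity)).trans (le_of_eq ?_))
    field_simp
    ring
  have hhead : ∑ t ∈ (Finset.Icc 1 A.card).filter (fun t => t ≤ t₀),
      ((richRatios A t).card : ℝ) ≤ t₀ * ((ratioSet A).card : ℝ) := by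
    have h1 : ∀ t ∈ (Finset.Icc 1 A.card).filter (fun t => t ≤ t₀),
        ((richRatios A t).card : ℝ) ≤ ((ratioSet A).card : ℝ) := fun t _ => by
      exact_mod_cast Finset.card_filter_le _ _
    refine (Finset.sum_le_card_nsmul _ _ _ h1).trans ?_
    rw [nsmul_eq_mul]
    refine mul_le_mul_of_nonneg_right ?_ (Nat.cast_nonneg _)
    have h2 : (Finset.Icc 1 A.card).filter (fun t => t ≤ t₀) ⊆ Finset.Icc 1 t₀ := by
      intro t ht
      simp only [Finset.mem_filter, Finset.mem_Icc] at ht ⊢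
      omega
    have h3 := Finset.card_le_card h2
    rw [Nat.card_Icc, Nat.add_sub_cancel] at h3
    exact_mod_cast h3
  have htotal : n ^ 2 ≤ ∑ t ∈ Finset.Icc 1 A.card, ((richRatios A t).card : ℝ) := by
    rw [hn]
    exact_mod_cast card_sq_le_sum_card_richRatios hA
  rw [← Finset.sum_filter_add_sum_filter_not _ (fun t => t ≤ t₀)] at htotal
  rw [one_div_mul_eq_div, div_le_iff₀ (by positivity)]
  linarith

/-! ### Reduction to positive reals -/

lemma quotSumSet_subset_of_smul_mem {A B : Finset ℝ} {σ : ℝ} (hσ : σ ≠ 0)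
    (h : ∀ b ∈ B, σ * b ∈ A) : quotSumSet B ⊆ quotSumSet A := by
  intro x hx
  obtain ⟨p, hp, rfl⟩ := Finset.mem_image.1 hx
  simp only [Finset.mem_filter, Finset.mem_product] at hp
  refine Finset.mem_image.2
    ⟨((σ * p.1.1, σ * p.1.2), (σ * p.2.1, σ * p.2.2)), Finset.mem_filter.2 ⟨?_, ?_⟩, ?_⟩
  · simp only [Finset.mem_product]
    exact ⟨⟨h _ hp.1.1.1, h _ hp.1.1.2⟩, h _ hp.1.2.1, h _ hp.1.2.2⟩
  · simp only [← mul_add]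
    exact mul_ne_zero hσ hp.2
  · simp only [← mul_add]
    exact mul_div_mul_left _ _ hσ

lemma ratioSet_subset_of_smul_mem {A B : Finset ℝ} {σ : ℝ} (hσ : σ ≠ 0)
    (h : ∀ b ∈ B, σ * b ∈ A) : ratioSet B ⊆ ratioSet A := by
  intro x hx
  obtain ⟨p, hp, rfl⟩ := Finset.mem_image.1 hx
  simp only [Finset.mem_filter, Finset.mem_product] at hp
  refine Finset.mem_image.2 ⟨(σ * p.1, σ * p.2), Finset.mem_filter.2 ⟨?_, ?_⟩, ?_⟩
  · simp only [Finset.mem_product]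
    exact ⟨h _ hp.1.1, h _ hp.1.2⟩
  · exact mul_ne_zero hσ hp.2
  · exact mul_div_mul_left _ _ hσ

lemma exists_pos_scaled_subset (A : Finset ℝ) (hA : 2 ≤ A.card) :
    ∃ (σ : ℝ) (B : Finset ℝ), σ ≠ 0 ∧ (∀ b ∈ B, 0 < b) ∧ (∀ b ∈ B, σ * b ∈ A) ∧
      A.card ≤ 3 * B.card := by
  have hcover : A ⊆ (A.filter (0 < ·)) ∪ (A.filter (· < 0)) ∪ {0} := by
    intro a ha
    simp only [Finset.mem_union, Finset.mem_filter, Finset.mem_singleton]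
    rcases lt_trichotomy a 0 with h | h | h <;> tauto
  have hcard := (Finset.card_le_card hcover).trans ((Finset.card_union_le _ _).trans
    (Nat.add_le_add_right (Finset.card_union_le _ _) _))
  rw [Finset.card_singleton] at hcard
  rcases le_total (A.filter (· < 0)).card (A.filter (0 < ·)).card with h | h
  · refine ⟨1, A.filter (0 < ·), one_ne_zero, fun b hb => (Finset.mem_filter.1 hb).2,
      fun b hb => ?_, by omega⟩
    rw [one_mul]
    exact (Finset.mem_filter.1 hb).1
  · refine ⟨-1, (A.filter (· < 0)).image (fun a => -a), by norm_num, fun b hb => ?_,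
      fun b hb => ?_, ?_⟩
    · obtain ⟨a, ha, rfl⟩ := Finset.mem_image.1 hb
      exact neg_pos.2 (Finset.mem_filter.1 ha).2
    · obtain ⟨a, ha, rfl⟩ := Finset.mem_image.1 hb
      rw [neg_one_mul, neg_neg]
      exact (Finset.mem_filter.1 ha).1
    · rw [Finset.card_image_of_injective _ neg_injective]
      omega

theorem stmt1 :
    ∀ C : ℝ, 0 < C → ∃ c : ℝ, 0 < c ∧ ∀ A : Finset ℝ, 2 ≤ A.card →
      ((quotSumSet A).card : ℝ) ≤ C * (A.card : ℝ) ^ 2 →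
      ((ratioSet A).card : ℝ) ≥ c * (A.card : ℝ) ^ 2 / (Real.logb 2 (A.card)) ^ 25 := by
  intro C hC
  obtain ⟨c, hc, hmain⟩ := exists_mul_card_sq_le_card_ratioSet_of_pos (C := 9 * C) (by positivity)
  refine ⟨c / 9, by positivity, fun A hA hAC => ?_⟩
  obtain ⟨σ, B, hσ, hBpos, hBA, hcard⟩ := exists_pos_scaled_subset A hA
  have hcard' : (A.card : ℝ) ^ 2 ≤ 9 * (B.card : ℝ) ^ 2 := by
    have : A.card ^ 2 ≤ (3 * B.card) ^ 2 := Nat.pow_le_pow_left hcard 2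
    have h9 : A.card ^ 2 ≤ 9 * B.card ^ 2 := by linarith [mul_pow 3 B.card 2]
    exact_mod_cast h9
  have hquot : ((quotSumSet B).card : ℝ) ≤ 9 * C * (B.card : ℝ) ^ 2 := by
    have h1 : ((quotSumSet B).card : ℝ) ≤ (quotSumSet A).card := by
      exact_mod_cast Finset.card_le_card (quotSumSet_subset_of_smul_mem hσ hBA)
    nlinarith [mul_le_mul_of_nonneg_left hcard' hC.le]
  have hratio : ((ratioSet B).card : ℝ) ≤ (ratioSet A).card := by
    exact_mod_cast Finset.card_le_card (ratioSet_subset_of_smul_mem hσ hBA)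
  have hlog : 1 ≤ (Real.logb 2 A.card) ^ 25 := by
    refine one_le_pow₀ ?_
    rw [Real.le_logb_iff_rpow_le (by norm_num) (by exact_mod_cast (by omega : 0 < A.card)),
      Real.rpow_one]
    exact_mod_cast hA
  have hB := hmain B hBpos hquot
  calc c / 9 * (A.card : ℝ) ^ 2 / (Real.logb 2 A.card) ^ 25 ≤ c / 9 * (A.card : ℝ) ^ 2 :=
        div_le_self (by positivity) hlog
    _ ≤ c / 9 * (9 * (B.card : ℝ) ^ 2) := by gcongr
    _ = c * (B.card : ℝ) ^ 2 := by ring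
    _ ≤ (ratioSet A).card := hB.trans hratio
end

section
/- Let r ≥ 2 and k ≥ 1 be integers and let G be an r-partite graph whose vertex set is the disjoint union of independent sets V_1, V_2, …, V_r, each of cardinality k. Suppose that for every pair 1 ≤ i < j ≤ r, the number of edges of G joining V_i to V_j is strictly greater than k²·(1 − 1/(e·(2r−3))), where e is Euler's number. Then G contains a clique of size r; equivalently, one can choose vertices v_i ∈ V_i for each 1 ≤ i ≤ r so that v_i and v_j are adjacent for all i ≠ j. -/
open scoped Classical

/-- A chaining step for the local lemma: if inside `S` each further bad event has conditional
frequency at most `x`, then avoiding the events of `W` costs a factor at most `(1 - x) ^ #W`. -/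
lemma pow_mul_card_avoid_le {α ι : Type*} (Ω : Finset α) (A : ι → α → Prop) {x : ℝ}
    (hx1 : x ≤ 1) (S : Finset ι)
    (h : ∀ T, T ⊂ S → ∀ i, i ∉ T →
      ((Ω.filter fun ω => A i ω ∧ ∀ j ∈ T, ¬ A j ω).card : ℝ) ≤
        x * (Ω.filter fun ω => ∀ j ∈ T, ¬ A j ω).card)
    (U W : Finset ι) (hUW : Disjoint U W) (hS : U ∪ W ⊆ S) :
    (1 - x) ^ W.card * ((Ω.filter fun ω => ∀ j ∈ U, ¬ A j ω).card : ℝ) ≤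
      (Ω.filter fun ω => ∀ j ∈ U ∪ W, ¬ A j ω).card := by
  induction W using Finset.induction_on with
  | empty => simp
  | insert a W ha ih =>
    rw [Finset.disjoint_insert_right] at hUW
    have hsub : U ∪ W ⊆ S := fun y hy => hS (by
      simp only [Finset.mem_union, Finset.mem_insert] at hy ⊢; tauto)
    have haUW : a ∉ U ∪ W := by simp [ha, hUW.1]
    have haS : a ∈ S := hS (by simp)
    have ih' := ih hUW.2 hsub
    have hstep := h (U ∪ W) ⟨hsub, fun hh => haUW (hh haS)⟩ a haUW
    have hsplit : ((Ω.filter fun ω => ∀ j ∈ U ∪ W, ¬ A j ω).card : ℝ) =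
        (Ω.filter fun ω => A a ω ∧ ∀ j ∈ U ∪ W, ¬ A j ω).card +
        (Ω.filter fun ω => ∀ j ∈ U ∪ insert a W, ¬ A j ω).card := by
      rw [← Finset.card_filter_add_card_filter_not (fun ω => A a ω), Finset.filter_filter,
        Finset.filter_filter]
      push_cast
      congr 3
      · ext ω; simp only [Finset.mem_filter]; tauto
      · ext ω
        rw [Finset.union_insert]
        simp only [Finset.mem_filter, Finset.forall_mem_insert]
        tauto
    rw [Finset.card_insert_of_notMem ha, pow_succ]
    have := mul_le_mul_of_nonneg_left ih' (sub_nonneg.2 hx1)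
    nlinarith

/-- The symmetric Lovász local lemma for the uniform measure on a finite set, where the
independence hypothesis is weakened to an upper bound on the conditional frequencies. -/
theorem exists_avoid_of_local_bound {α ι : Type*} [Finite ι] (Ω : Finset α) (hΩ : Ω.Nonempty)
    (A : ι → α → Prop) (Γ : ι → Finset ι) (d : ℕ) {x p : ℝ} (hx0 : 0 ≤ x) (hx1 : x < 1)
    (hp : p ≤ x * (1 - x) ^ d) (hΓ : ∀ i, (Γ i).card ≤ d)
    (hA : ∀ i, ∀ S : Finset ι, i ∉ S → Disjoint S (Γ i) →
      ((Ω.filter fun ω => A i ω ∧ ∀ j ∈ S, ¬ A j ω).card : ℝ) ≤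
        p * (Ω.filter fun ω => ∀ j ∈ S, ¬ A j ω).card) :
    ∃ ω ∈ Ω, ∀ i, ¬ A i ω := by
  have key : ∀ S : Finset ι, ∀ i, i ∉ S →
      ((Ω.filter fun ω => A i ω ∧ ∀ j ∈ S, ¬ A j ω).card : ℝ) ≤
        x * (Ω.filter fun ω => ∀ j ∈ S, ¬ A j ω).card := by
    intro S
    induction S using Finset.strongInduction with
    | H S ih =>
      intro i hi
      have hchain := pow_mul_card_avoid_le Ω A hx1.le S ih (S \ Γ i) (S ∩ Γ i)
        (Finset.disjoint_sdiff_inter S (Γ i)) (by rw [Finset.sdiff_union_inter])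
      rw [Finset.sdiff_union_inter] at hchain
      have hfar := hA i (S \ Γ i) (fun h => hi (Finset.mem_sdiff.1 h).1) Finset.sdiff_disjoint
      have hmono : ((Ω.filter fun ω => A i ω ∧ ∀ j ∈ S, ¬ A j ω).card : ℝ) ≤
          (Ω.filter fun ω => A i ω ∧ ∀ j ∈ S \ Γ i, ¬ A j ω).card := by
        refine Nat.cast_le.2 (Finset.card_le_card
          (Finset.monotone_filter_right Ω (fun ω _ h => ⟨h.1, fun j hj => h.2 j ?_⟩)))
        exact (Finset.mem_sdiff.1 hj).1
      have hpow : (1 - x) ^ d ≤ (1 - x) ^ (S ∩ Γ i).card :=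
        pow_le_pow_of_le_one (by linarith) (by linarith)
          ((Finset.card_le_card Finset.inter_subset_right).trans (hΓ i))
      have hp' : p ≤ x * (1 - x) ^ (S ∩ Γ i).card :=
        hp.trans (mul_le_mul_of_nonneg_left hpow hx0)
      calc _ ≤ _ := hmono
        _ ≤ _ := hfar
        _ ≤ x * (1 - x) ^ (S ∩ Γ i).card *
            ((Ω.filter fun ω => ∀ j ∈ S \ Γ i, ¬ A j ω).card : ℝ) :=
          mul_le_mul_of_nonneg_right hp' (Nat.cast_nonneg _)
        _ ≤ _ := by rw [mul_assoc]; exact mul_le_mul_of_nonneg_left hchain hx0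
  obtain ⟨W, hW⟩ : ∃ W : Finset ι, ∀ i, i ∈ W :=
    ⟨Set.finite_univ.toFinset, fun i => by simp⟩
  have hfin := pow_mul_card_avoid_le Ω A hx1.le W (fun T _ => key T) ∅ W
    (Finset.disjoint_empty_left _) (Finset.empty_union W).subset
  have hpos : (0 : ℝ) < (1 - x) ^ W.card *
      ((Ω.filter fun ω => ∀ j ∈ (∅ : Finset ι), ¬ A j ω).card : ℝ) := by
    have : 0 < Ω.card := hΩ.card_pos
    refine mul_pos (pow_pos (by linarith) _) ?_
    simpa using this
  have hcard := (Nat.cast_pos (α := ℝ)).1 (hpos.trans_le hfin)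
  obtain ⟨ω, hω⟩ := Finset.card_pos.1 hcard
  rw [Finset.mem_filter] at hω
  exact ⟨ω, hω.1, fun i => hω.2 i (by simp [hW])⟩

lemma sum_piFinset_sum_update {ι V : Type*} [Fintype ι] [DecidableEq ι] (P : ι → Finset V)
    (i : ι) (f : (ι → V) → ℝ) :
    ∑ v ∈ Fintype.piFinset P, ∑ a ∈ P i, f (Function.update v i a) =
      (P i).card * ∑ v ∈ Fintype.piFinset P, f v := by
  have h : ∑ v ∈ Fintype.piFinset P, ∑ a ∈ P i, f (Function.update v i a) =
      ∑ v ∈ Fintype.piFinset P, ∑ _a ∈ P i, f v := by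
    rw [← Finset.sum_product', ← Finset.sum_product']
    have hmem : ∀ q ∈ Fintype.piFinset P ×ˢ P i,
        (Function.update q.1 i q.2, q.1 i) ∈ Fintype.piFinset P ×ˢ P i := by
      intro q hq
      rw [Finset.mem_product, Fintype.mem_piFinset] at hq
      rw [Finset.mem_product, Fintype.mem_piFinset]
      refine ⟨fun j => ?_, hq.1 i⟩
      by_cases hj : j = i
      · subst hj; simpa using hq.2
      · simpa [hj] using hq.1 j
    exact Finset.sum_nbij' (fun q => (Function.update q.1 i q.2, q.1 i))
      (fun q => (Function.update q.1 i q.2, q.1 i)) hmem hmem (by simp) (by simp) (by simp)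
  rw [h]
  simp [Finset.mul_sum]

/-- Uniform choice from a product: an event on the coordinates `i ≠ j` of frequency at most `p`
has frequency at most `p` conditionally on any event not depending on these coordinates. -/
lemma card_pair_event_and_le {ι V : Type*} [Fintype ι] [DecidableEq ι] (P : ι → Finset V)
    {i j : ι} (hij : i ≠ j) (hi : (P i).Nonempty) (hj : (P j).Nonempty)
    (B : V → V → Prop) (Q : (ι → V) → Prop) {p : ℝ}
    (hB : (((P i ×ˢ P j).filter fun q => B q.1 q.2).card : ℝ) ≤
      p * ((P i).card * (P j).card))
    (hQ : ∀ v a b, Q (Function.update (Function.update v i a) j b) ↔ Q v) :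
    (((Fintype.piFinset P).filter fun v => B (v i) (v j) ∧ Q v).card : ℝ) ≤
      p * ((Fintype.piFinset P).filter Q).card := by
  set f : (ι → V) → ℝ := fun v => if B (v i) (v j) ∧ Q v then 1 else 0 with hf
  have hsum : ∑ v ∈ Fintype.piFinset P, ∑ a ∈ P i, ∑ b ∈ P j,
      f (Function.update (Function.update v i a) j b) =
      (P i).card * ((P j).card * ∑ v ∈ Fintype.piFinset P, f v) := by
    rw [sum_piFinset_sum_update P i (fun w => ∑ b ∈ P j, f (Function.update w j b)),
      sum_piFinset_sum_update]
  have hinner : ∀ v, ∑ a ∈ P i, ∑ b ∈ P j, f (Function.update (Function.update v i a) j b) =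
      (((P i ×ˢ P j).filter fun q => B q.1 q.2).card : ℝ) * (if Q v then 1 else 0) := by
    intro v
    rw [← Finset.sum_boole, Finset.sum_mul, Finset.sum_product]
    refine Finset.sum_congr rfl fun a _ => Finset.sum_congr rfl fun b _ => ?_
    simp only [hf, hQ, Function.update_self, Function.update_of_ne hij]
    by_cases h1 : B a b <;> by_cases h2 : Q v <;> simp [h1, h2]
  rw [Finset.sum_congr rfl fun v _ => hinner v, ← Finset.mul_sum, Finset.sum_boole,
    Finset.sum_boole] at hsum
  have hpi : (0 : ℝ) < (P i).card := Nat.cast_pos.2 hi.card_pos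
  have hpj : (0 : ℝ) < (P j).card := Nat.cast_pos.2 hj.card_pos
  have h2 := mul_le_mul_of_nonneg_right hB
    (Nat.cast_nonneg (α := ℝ) ((Fintype.piFinset P).filter Q).card)
  rw [hsum] at h2
  refine le_of_mul_le_mul_left ?_ (mul_pos hpi hpj)
  linarith

lemma exp_neg_one_le_one_sub_inv_pow (d : ℕ) (hd : 0 < d) :
    (Real.exp 1)⁻¹ ≤ (1 - 1 / ((d : ℝ) + 1)) ^ d := by
  have hd' : (0 : ℝ) < d := Nat.cast_pos.2 hd
  have h1 : 1 - 1 / ((d : ℝ) + 1) = (1 + 1 / (d : ℝ))⁻¹ := by field_simp; ring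
  rw [h1, inv_pow]
  refine inv_anti₀ (by positivity) ?_
  calc (1 + 1 / (d : ℝ)) ^ d ≤ (Real.exp (1 / d)) ^ d := by
        refine pow_le_pow_left₀ (by positivity) ?_ d
        linarith [Real.add_one_le_exp (1 / (d : ℝ))]
    _ = Real.exp 1 := by rw [← Real.exp_nat_mul]; congr 1; field_simp

/-- The ordered pairs `q` with `q.1 < q.2` that meet the pair `p` in exactly one element. -/
def adjacentPairs {r : ℕ} (p : Fin r × Fin r) : Finset (Fin r × Fin r) :=
  if p.1 < p.2 then
    (Finset.univ \ {p.1, p.2}).image (fun c => (min p.1 c, max p.1 c)) ∪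
      (Finset.univ \ {p.1, p.2}).image (fun c => (min p.2 c, max p.2 c))
  else ∅

lemma card_adjacentPairs_le {r : ℕ} (p : Fin r × Fin r) :
    (adjacentPairs p).card ≤ 2 * (r - 2) := by
  unfold adjacentPairs
  split_ifs with h
  · have hc : (Finset.univ \ {p.1, p.2} : Finset (Fin r)).card = r - 2 := by
      rw [Finset.card_sdiff_of_subset (Finset.subset_univ _), Finset.card_pair h.ne]
      simp
    refine (Finset.card_union_le _ _).trans ?_
    rw [two_mul]
    exact Nat.add_le_add (Finset.card_image_le.trans hc.le) (Finset.card_image_le.trans hc.le)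
  · simp

lemma ne_of_notMem_adjacentPairs {r : ℕ} {p q : Fin r × Fin r} (hp : p.1 < p.2)
    (hq : q.1 < q.2) (hqp : q ≠ p) (h : q ∉ adjacentPairs p) :
    (q.1 ≠ p.1 ∧ q.1 ≠ p.2) ∧ (q.2 ≠ p.1 ∧ q.2 ≠ p.2) := by
  obtain ⟨i, j⟩ := p
  obtain ⟨a, b⟩ := q
  simp only [adjacentPairs, if_pos hp, Finset.mem_union, Finset.mem_image, Finset.mem_sdiff,
    Finset.mem_univ, true_and, Finset.mem_insert, Finset.mem_singleton, not_or, not_exists,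
    not_and, Prod.mk.injEq] at h
  simp only [ne_eq, Prod.mk.injEq, not_and] at hqp hp hq ⊢
  obtain ⟨h1, h2⟩ := h
  refine ⟨⟨?_, ?_⟩, ?_, ?_⟩
  · rintro rfl
    exact h1 b ⟨hq.ne', hqp rfl⟩ (min_eq_left hq.le) (max_eq_right hq.le)
  · rintro rfl
    exact h2 b ⟨(hp.trans hq).ne', hq.ne'⟩ (min_eq_left hq.le) (max_eq_right hq.le)
  · rintro rfl
    exact h1 a ⟨hq.ne, (hq.trans hp).ne⟩ (min_eq_right hq.le) (max_eq_left hq.le)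
  · rintro rfl
    exact h2 a ⟨fun hai => hqp hai rfl, hq.ne⟩ (min_eq_right hq.le) (max_eq_left hq.le)

theorem stmt2 {V : Type*} (G : SimpleGraph V) (r k : ℕ) (hr : 2 ≤ r) (hk : 1 ≤ k)
    (parts : Fin r → Finset V)
    (hcover : ∀ v : V, ∃ i, v ∈ parts i)
    (hdisj : ∀ i j : Fin r, i ≠ j → Disjoint (parts i) (parts j))
    (hcard : ∀ i, (parts i).card = k)
    (hindep : ∀ i : Fin r, ∀ v ∈ parts i, ∀ w ∈ parts i, ¬ G.Adj v w)
    (hedges : ∀ i j : Fin r, i < j →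
      (k : ℝ) ^ 2 * (1 - 1 / (Real.exp 1 * (2 * (r : ℝ) - 3))) <
        ((((parts i) ×ˢ (parts j)).filter fun p => G.Adj p.1 p.2).card : ℝ)) :
    ∃ v : Fin r → V, (∀ i, v i ∈ parts i) ∧ ∀ i j : Fin r, i ≠ j → G.Adj (v i) (v j) := by
  obtain rfl | hr3 := hr.eq_or_lt
  · have h := hedges 0 1 (by decide)
    have he : 1 / (Real.exp 1 * (2 * ((2 : ℕ) : ℝ) - 3)) ≤ 1 := by
      rw [div_le_one (by norm_num [Real.exp_pos])]
      norm_num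
    have h0 := (mul_nonneg (sq_nonneg (k : ℝ)) (sub_nonneg.2 he)).trans_lt h
    obtain ⟨⟨a, b⟩, hab⟩ := Finset.card_pos.1 (Nat.cast_pos.1 h0)
    simp only [Finset.mem_filter, Finset.mem_product] at hab
    refine ⟨![a, b], ?_, ?_⟩
    · rw [Fin.forall_fin_two]
      exact hab.1
    · simp [Fin.forall_fin_two, hab.2, hab.2.symm]
  have hne : ∀ i, (parts i).Nonempty := fun i => Finset.card_pos.1 (by rw [hcard]; omega)
  set d : ℕ := 2 * (r - 2) with hd
  have hdr : 2 * (r : ℝ) - 3 = (d : ℝ) + 1 := by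
    rw [hd]; push_cast [Nat.cast_sub hr]; ring
  have hd0 : 0 < d := by omega
  have hd0' : (0 : ℝ) < d := Nat.cast_pos.2 hd0
  rw [hdr] at hedges
  have hp : 1 / (Real.exp 1 * ((d : ℝ) + 1)) ≤
      1 / ((d : ℝ) + 1) * (1 - 1 / ((d : ℝ) + 1)) ^ d := by
    have := mul_le_mul_of_nonneg_left (exp_neg_one_le_one_sub_inv_pow d hd0)
      (by positivity : (0 : ℝ) ≤ 1 / ((d : ℝ) + 1))
    refine le_of_eq_of_le ?_ this
    field_simp
  obtain ⟨v, hv, hgood⟩ := exists_avoid_of_local_bound (Fintype.piFinset parts)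
    (Fintype.piFinset_nonempty.2 hne)
    (fun (q : Fin r × Fin r) v => q.1 < q.2 ∧ ¬ G.Adj (v q.1) (v q.2)) adjacentPairs d
    (by positivity) (by rw [div_lt_one (by positivity)]; linarith) hp card_adjacentPairs_le (by
      rintro q S hqS hS
      by_cases hq : q.1 < q.2
      · have hB : (((parts q.1 ×ˢ parts q.2).filter fun s => ¬ G.Adj s.1 s.2).card : ℝ) ≤
            1 / (Real.exp 1 * ((d : ℝ) + 1)) * ((parts q.1).card * (parts q.2).card) := by
          have h1 := hedges q.1 q.2 hq
          have h2 := Finset.card_filter_add_card_filter_not (s := parts q.1 ×ˢ parts q.2)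
            (fun s => G.Adj s.1 s.2)
          rw [Finset.card_product, hcard, hcard] at h2
          have h3 := congrArg (Nat.cast (R := ℝ)) h2
          push_cast at h3
          rw [hcard, hcard]
          linarith
        have := card_pair_event_and_le parts hq.ne (hne _) (hne _) (fun a b => ¬ G.Adj a b)
          (fun v => ∀ s ∈ S, ¬ (s.1 < s.2 ∧ ¬ G.Adj (v s.1) (v s.2)))
          (p := 1 / (Real.exp 1 * ((d : ℝ) + 1))) (by convert hB) (by
            intro v a b
            refine forall₂_congr fun s hs => not_congr (and_congr_right fun hlt => ?_)
            obtain ⟨⟨h1, h2⟩, h3, h4⟩ := ne_of_notMem_adjacentPairs hq hlt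
              (fun h => hqS (h ▸ hs)) (Finset.disjoint_left.1 hS hs)
            rw [Function.update_of_ne h2, Function.update_of_ne h1,
              Function.update_of_ne h4, Function.update_of_ne h3])
        simp only [hq, true_and]
        convert this
      · simp only [hq, false_and, Finset.filter_false, Finset.card_empty, Nat.cast_zero]
        positivity)
  rw [Fintype.mem_piFinset] at hv
  refine ⟨v, hv, fun i j hij => ?_⟩
  rcases hij.lt_or_gt with h | h
  · by_contra hc
    exact hgood (i, j) ⟨h, hc⟩
  · by_contra hc
    exact hgood (j, i) ⟨h, fun hh => hc hh.symm⟩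
end

section
/- For every integer r ≥ 2 and every integer k ≥ 1 divisible by r−1, there exists an r-partite graph G' with parts V_1, …, V_r, each of cardinality k, such that for every pair 1 ≤ i < j ≤ r the number of edges joining V_i to V_j is at least k²·(1 − 1/(r−1)), and yet G' contains no clique of size r. -/
open scoped Classical

/-- The graph on `r` parts, each split into `s` colour classes of size `m`, joining vertices that
differ both in part and in colour. -/
def partColorGraph (r s m : ℕ) : SimpleGraph (Fin r × Fin s × Fin m) where
  Adj v w := v.1 ≠ w.1 ∧ v.2.1 ≠ w.2.1
  symm := ⟨fun _ _ h => ⟨h.1.symm, h.2.symm⟩⟩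
  loopless := ⟨fun _ h => h.1 rfl⟩

theorem partColorGraph_cliqueFree {r s n : ℕ} (m : ℕ) (h : s < n) :
    (partColorGraph r s m).CliqueFree n :=
  SimpleGraph.Colorable.cliqueFree (n := s)
    ⟨SimpleGraph.Coloring.mk (fun v => v.2.1) fun hvw => hvw.2⟩ h

theorem le_card_partColorGraph_edges {r s m : ℕ} {i j : Fin r} (hij : i ≠ j) :
    (s * s - s) * (m * m) ≤
      (((({i} : Finset (Fin r)) ×ˢ (Finset.univ : Finset (Fin s × Fin m))) ×ˢ
        (({j} : Finset (Fin r)) ×ˢ (Finset.univ : Finset (Fin s × Fin m)))).filter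
          fun p => (partColorGraph r s m).Adj p.1 p.2).card := by
  have hcard : ((Finset.univ : Finset (Fin s)).offDiag ×ˢ
      (Finset.univ : Finset (Fin m × Fin m))).card = (s * s - s) * (m * m) := by
    simp [Finset.offDiag_card]
  rw [← hcard]
  refine Finset.card_le_card_of_injOn
    (fun q => ((i, q.1.1, q.2.1), (j, q.1.2, q.2.2))) ?_ ?_
  · rintro ⟨⟨c, d⟩, a, b⟩ hq
    simpa [partColorGraph, hij] using hq
  · rintro ⟨⟨c, d⟩, a, b⟩ _ ⟨⟨c', d'⟩, a', b'⟩ _ h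
    simp_all

theorem stmt3 (r k : ℕ) (hr : 2 ≤ r) (hk : 1 ≤ k) (hdvd : (r - 1) ∣ k) :
    ∃ (V : Type) (_ : Fintype V) (G : SimpleGraph V) (parts : Fin r → Finset V),
      (∀ v : V, ∃ i, v ∈ parts i) ∧
      (∀ i j : Fin r, i ≠ j → Disjoint (parts i) (parts j)) ∧
      (∀ i, (parts i).card = k) ∧
      (∀ i : Fin r, ∀ v ∈ parts i, ∀ w ∈ parts i, ¬ G.Adj v w) ∧
      (∀ i j : Fin r, i < j →
        (k : ℝ) ^ 2 * (1 - 1 / ((r : ℝ) - 1)) ≤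
          ((((parts i) ×ˢ (parts j)).filter fun p => G.Adj p.1 p.2).card : ℝ)) ∧
      G.CliqueFree r := by
  obtain ⟨s, rfl⟩ : ∃ s, r = s + 1 := ⟨r - 1, by omega⟩
  obtain ⟨m, rfl⟩ := hdvd
  simp only [Nat.add_sub_cancel]
  refine ⟨Fin (s + 1) × Fin s × Fin m, inferInstance, partColorGraph (s + 1) s m,
    fun i => {i} ×ˢ Finset.univ, fun v => ⟨v.1, by simp⟩, ?_, by simp, ?_, ?_,
    partColorGraph_cliqueFree m s.lt_succ_self⟩
  · intro i j hij
    exact Finset.disjoint_product.2 (Or.inl (by simpa using hij))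
  · intro i v hv w hw h
    simp only [Finset.mem_product, Finset.mem_singleton, Finset.mem_univ, and_true] at hv hw
    exact h.1 (hv.trans hw.symm)
  · intro i j hij
    have hs : (s : ℝ) ≠ 0 := by
      have : s ≠ 0 := by omega
      exact_mod_cast this
    have hle := Nat.cast_le (α := ℝ).2 (le_card_partColorGraph_edges (s := s) (m := m) hij.ne)
    refine le_trans (le_of_eq ?_) (hle.trans (le_of_eq ?_))
    · push_cast [Nat.cast_sub (Nat.le_mul_self s), add_sub_cancel_right]
      field_simp
    · congr!
end

section
/- If A is a finite nonempty set of strictly positive real numbers, then |(A+A)/(A+A)| ≥ 2|A|² − 1. -/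
open scoped Classical

/-- Adding points of abscissa in `X` on the ray of slope `s` to points of abscissa in `Y` on the ray
of slope `t` gives at least `|X| + |Y| - 1` distinct slopes, all strictly between `s` and `t`. -/
theorem card_add_card_le_card_mediant_Ioo {X Y T : Finset ℝ} {s t : ℝ} (hst : s < t)
    (hX : X.Nonempty) (hY : Y.Nonempty) (hX0 : ∀ x ∈ X, 0 < x) (hY0 : ∀ y ∈ Y, 0 < y)
    (hT : ∀ x ∈ X, ∀ y ∈ Y, (x * s + y * t) / (x + y) ∈ T) :
    X.card + Y.card ≤ (T.filter fun r => s < r ∧ r < t).card + 1 := by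
  obtain ⟨x₀, hx₀, hxm⟩ := X.exists_min_image id hX
  obtain ⟨y₀, hy₀, hym⟩ := Y.exists_min_image id hY
  simp only [id] at hxm hym
  set f : ℝ → ℝ → ℝ := fun x y => (x * s + y * t) / (x + y) with hf
  have hle : ∀ x y x' y', 0 < x → 0 < y → 0 < x' → 0 < y' →
      (f x y ≤ f x' y' ↔ y * x' ≤ y' * x) := by
    intro x y x' y' hx hy hx' hy'
    rw [hf]
    simp only
    rw [div_le_div_iff₀ (by positivity) (by positivity)]
    constructor
    · intro h
      by_contra! h'
      nlinarith [mul_pos (sub_pos.2 h') (sub_pos.2 hst)]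
    · intro h
      nlinarith [mul_nonneg (sub_nonneg.2 h) (sub_pos.2 hst).le]
  have hIoo : ∀ x ∈ X, ∀ y ∈ Y, f x y ∈ T.filter fun r => s < r ∧ r < t := by
    intro x hx y hy
    have h1 := hX0 x hx
    have h2 := hY0 y hy
    refine Finset.mem_filter.2 ⟨hT x hx y hy, ?_, ?_⟩
    · rw [hf]
      simp only
      rw [lt_div_iff₀ (by positivity)]
      nlinarith
    · rw [hf]
      simp only
      rw [div_lt_iff₀ (by positivity)]
      nlinarith
  have px := hX0 x₀ hx₀
  have py := hY0 y₀ hy₀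
  have c1 : (X.image fun x => f x y₀).card = X.card := by
    refine Finset.card_image_of_injOn fun x hx x' hx' h => ?_
    have p1 := hX0 x hx
    have p2 := hX0 x' hx'
    have a := (hle x y₀ x' y₀ p1 py p2 py).1 h.le
    have b := (hle x' y₀ x y₀ p2 py p1 py).1 h.ge
    exact le_antisymm (le_of_mul_le_mul_left b py) (le_of_mul_le_mul_left a py)
  have c2 : (Y.image fun y => f x₀ y).card = Y.card := by
    refine Finset.card_image_of_injOn fun y hy y' hy' h => ?_
    have p1 := hY0 y hy
    have p2 := hY0 y' hy'
    have a := (hle x₀ y x₀ y' px p1 px p2).1 h.le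
    have b := (hle x₀ y' x₀ y px p2 px p1).1 h.ge
    exact le_antisymm (le_of_mul_le_mul_right a px) (le_of_mul_le_mul_right b px)
  have hinter : ((X.image fun x => f x y₀) ∩ (Y.image fun y => f x₀ y)).card ≤ 1 := by
    rw [← Finset.card_singleton (f x₀ y₀)]
    refine Finset.card_le_card fun r hr => ?_
    rw [Finset.mem_inter, Finset.mem_image, Finset.mem_image] at hr
    obtain ⟨⟨x, hx, rfl⟩, y, hy, h⟩ := hr
    rw [Finset.mem_singleton]
    apply le_antisymm
    · rw [hle x y₀ x₀ y₀ (hX0 x hx) py px py]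
      exact mul_le_mul_of_nonneg_left (hxm x hx) py.le
    · rw [← h, hle x₀ y₀ x₀ y px py px (hY0 y hy)]
      exact mul_le_mul_of_nonneg_right (hym y hy) px.le
  have hsub : (X.image fun x => f x y₀) ∪ (Y.image fun y => f x₀ y) ⊆
      T.filter fun r => s < r ∧ r < t := by
    intro r hr
    rw [Finset.mem_union, Finset.mem_image, Finset.mem_image] at hr
    rcases hr with ⟨x, hx, rfl⟩ | ⟨y, hy, rfl⟩
    · exact hIoo x hx y₀ hy₀
    · exact hIoo x₀ hx₀ y hy
  have := Finset.card_le_card hsub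
  have := Finset.card_union_add_card_inter (X.image fun x => f x y₀) (Y.image fun y => f x₀ y)
  omega

/-- Given points in the right half-plane, with those on the ray of slope `s` having abscissae `X s`,
this bounds from below the number of slopes of their pairwise sums. -/
theorem two_mul_sum_card_lt_card_mediants (X : ℝ → Finset ℝ) (S : Finset ℝ) :
    ∀ (a b : ℝ) (T : Finset ℝ), (∀ s ∈ S, (X s).Nonempty) → (∀ s ∈ S, ∀ x ∈ X s, 0 < x) →
      a ∈ S → (∀ s ∈ S, a ≤ s) → b ∈ S → (∀ s ∈ S, s ≤ b) →
      (∀ s ∈ S, ∀ t ∈ S, ∀ x ∈ X s, ∀ y ∈ X t, (x * s + y * t) / (x + y) ∈ T) →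
      2 * ∑ s ∈ S, (X s).card + 1 ≤ T.card + (X a).card + (X b).card := by
  induction S using Finset.induction_on_max with
  | empty =>
    intro a b T _ _ ha
    simp at ha
  | insert m S hm ih =>
    intro a b T hne hpos ha hamin hb hbmax hT
    have hmS : m ∉ S := fun h => lt_irrefl _ (hm m h)
    have hbm : b = m := by
      refine le_antisymm ?_ (hbmax m (Finset.mem_insert_self _ _))
      rcases Finset.mem_insert.1 hb with h | h
      · exact h.le
      · exact (hm b h).le
    subst hbm
    have hbT : b ∈ T := by
      obtain ⟨x, hx⟩ := hne b hb
      have hx0 := hpos b hb x hx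
      have := hT b hb b hb x hx x hx
      rwa [← add_mul, mul_div_cancel_left₀ _ (by positivity)] at this
    rw [Finset.sum_insert hmS]
    rcases S.eq_empty_or_nonempty with rfl | hS
    · have hab : a = b := by simpa using ha
      subst hab
      have := Finset.card_pos.2 ⟨_, hbT⟩
      simp only [Finset.sum_empty]
      omega
    · obtain ⟨M, hMS, hM⟩ := S.exists_max_image id hS
      simp only [id] at hM
      have haS : a ∈ S := by
        rcases Finset.mem_insert.1 ha with h | h
        · have h1 := hm M hMS
          have h2 := hamin M (Finset.mem_insert_of_mem hMS)
          linarith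
        · exact h
      have lift : ∀ {s}, s ∈ S → s ∈ insert b S := fun h => Finset.mem_insert_of_mem h
      have h1 := ih a M (T.filter (· ≤ M)) (fun s h => hne s (lift h))
        (fun s h => hpos s (lift h)) haS (fun s h => hamin s (lift h)) hMS hM (by
          intro s hs t ht x hx y hy
          refine Finset.mem_filter.2 ⟨hT s (lift hs) t (lift ht) x hx y hy, ?_⟩
          have px := hpos s (lift hs) x hx
          have py := hpos t (lift ht) y hy
          rw [div_le_iff₀ (by positivity)]
          nlinarith [hM s hs, hM t ht])
      have h2 := card_add_card_le_card_mediant_Ioo (hm M hMS) (hne M (lift hMS)) (hne b hb)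
        (hpos M (lift hMS)) (hpos b hb) (hT M (lift hMS) b hb)
      have hd : Disjoint (T.filter (· ≤ M)) (T.filter fun r => M < r ∧ r < b) := by
        refine Finset.disjoint_left.2 fun r hr hr' => ?_
        exact absurd (Finset.mem_filter.1 hr).2 (not_le.2 (Finset.mem_filter.1 hr').2.1)
      have hnot : b ∉ T.filter (· ≤ M) ∪ T.filter fun r => M < r ∧ r < b := by
        have := hm M hMS
        simp [this]
      have h3 : (insert b (T.filter (· ≤ M) ∪ T.filter fun r => M < r ∧ r < b)).card ≤ T.card := by
        refine Finset.card_le_card (Finset.insert_subset hbT ?_)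
        exact Finset.union_subset (Finset.filter_subset _ _) (Finset.filter_subset _ _)
      rw [Finset.card_insert_of_notMem hnot, Finset.card_union_of_disjoint hd] at h3
      omega

theorem stmt4 (A : Finset ℝ) (hne : A.Nonempty) (hpos : ∀ a ∈ A, 0 < a) :
    ((quotSumSet A).card : ℝ) ≥ 2 * (A.card : ℝ) ^ 2 - 1 := by
  obtain ⟨m, hm, hmin⟩ := A.exists_min_image id hne
  obtain ⟨M, hM, hmax⟩ := A.exists_max_image id hne
  simp only [id] at hmin hmax
  have pm := hpos m hm
  have pM := hpos M hM
  set S : Finset ℝ := (A ×ˢ A).image fun p => p.2 / p.1 with hS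
  set X : ℝ → Finset ℝ := fun s => A.filter fun x => x * s ∈ A with hXdef
  have memS : ∀ x ∈ A, ∀ y ∈ A, y / x ∈ S := fun x hx y hy =>
    Finset.mem_image.2 ⟨(x, y), Finset.mem_product.2 ⟨hx, hy⟩, rfl⟩
  have ofS : ∀ s ∈ S, ∃ x ∈ A, ∃ y ∈ A, y / x = s := by
    intro s hs
    obtain ⟨p, hp, rfl⟩ := Finset.mem_image.1 hs
    exact ⟨p.1, (Finset.mem_product.1 hp).1, p.2, (Finset.mem_product.1 hp).2, rfl⟩
  have memX : ∀ s x, x ∈ X s ↔ x ∈ A ∧ x * s ∈ A := fun s x => Finset.mem_filter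
  have hsum : ∑ s ∈ S, (X s).card = A.card ^ 2 := by
    rw [sq, ← Finset.card_product, Finset.card_eq_sum_card_image (fun p : ℝ × ℝ => p.2 / p.1)]
    refine Finset.sum_congr rfl fun s _ => ?_
    refine Finset.card_bij (fun x _ => (x, x * s)) ?_ ?_ ?_
    · intro x hx
      rw [memX] at hx
      have := hpos x hx.1
      simp [hx.1, hx.2, this.ne']
    · intro x _ y _ h
      exact (Prod.ext_iff.1 h).1
    · rintro ⟨x, y⟩ h
      simp only [Finset.mem_filter, Finset.mem_product] at h
      obtain ⟨⟨hx, hy⟩, rfl⟩ := h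
      have h0 : x * (y / x) = y := mul_div_cancel₀ _ (hpos x hx).ne'
      exact ⟨x, (memX _ _).2 ⟨hx, h0.symm ▸ hy⟩, by rw [h0]⟩
  have key := two_mul_sum_card_lt_card_mediants X S (m / M) (M / m) (quotSumSet A)
    (by
      intro s hs
      obtain ⟨x, hx, y, hy, rfl⟩ := ofS s hs
      refine ⟨x, (memX _ _).2 ⟨hx, ?_⟩⟩
      rwa [mul_div_cancel₀ _ (hpos x hx).ne'])
    (fun s _ x hx => hpos x ((memX _ _).1 hx).1)
    (memS M hM m hm)
    (by
      intro s hs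
      obtain ⟨x, hx, y, hy, rfl⟩ := ofS s hs
      exact div_le_div₀ (hpos y hy).le (hmin y hy) (hpos x hx) (hmax x hx))
    (memS m hm M hM)
    (by
      intro s hs
      obtain ⟨x, hx, y, hy, rfl⟩ := ofS s hs
      exact div_le_div₀ pM.le (hmax y hy) pm (hmin x hx))
    (by
      intro s _ t _ x hx y hy
      rw [memX] at hx hy
      have px := hpos x hx.1
      have py := hpos y hy.1
      refine Finset.mem_image.2 ⟨((x * s, y * t), (x, y)), Finset.mem_filter.2 ⟨?_, ?_⟩, rfl⟩
      · simp [hx, hy]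
      · exact (add_pos px py).ne')
  have h1 : (X (m / M)).card ≤ 1 := by
    rw [← Finset.card_singleton M]
    refine Finset.card_le_card fun x hx => Finset.mem_singleton.2 ?_
    rw [memX] at hx
    refine le_antisymm (hmax x hx.1) ?_
    have := hmin _ hx.2
    rw [← mul_div_assoc, le_div_iff₀ pM] at this
    nlinarith
  have h2 : (X (M / m)).card ≤ 1 := by
    rw [← Finset.card_singleton m]
    refine Finset.card_le_card fun x hx => Finset.mem_singleton.2 ?_
    rw [memX] at hx
    refine le_antisymm ?_ (hmin x hx.1)
    have := hmax _ hx.2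
    rw [← mul_div_assoc, div_le_iff₀ pm] at this
    nlinarith
  rw [hsum] at key
  have h3 : 2 * A.card ^ 2 ≤ (quotSumSet A).card + 1 := by omega
  have h4 : 2 * (A.card : ℝ) ^ 2 ≤ (quotSumSet A).card + 1 := by exact_mod_cast h3
  linarith
end

section
/- Let λ₁, λ₂, λ, λ' be real numbers with λ₁ ≠ λ₂, λ ∉ {λ₁, λ₂} and λ' ∉ {λ₁, λ₂}, and let a, b be positive reals with (a, λ) ≠ (b, λ'). Define the curves C₁ := {(x,y) ∈ ℝ² : (λa + λ₁x)(a + y) = (λa + λ₂y)(a + x)} and C₂ := {(x,y) ∈ ℝ² : (λ'b + λ₁x)(b + y) = (λ'b + λ₂y)(b + x)}. Then C₁ ∩ C₂ contains at most 2 points. -/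
/-- Two distinct conics `A y + B x + d x y = 0` whose coefficients `A`, `B` are nonzero meet in at
most one point besides the origin. -/
theorem eq_zero_or_eq_of_mem_conics {K : Type*} [Field K] {A B A' B' d x y : K} (hd : d ≠ 0)
    (hA : A ≠ 0) (hB : B ≠ 0) (hne : A - A' ≠ 0 ∨ B - B' ≠ 0)
    (h : A * y + B * x + d * (x * y) = 0) (h' : A' * y + B' * x + d * (x * y) = 0) :
    (x = 0 ∧ y = 0) ∨
      (x = (B * (A - A') - A * (B - B')) / (d * (B - B')) ∧
        y = (A * (B - B') - B * (A - A')) / (d * (A - A'))) := by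
  have hline : (A - A') * y + (B - B') * x = 0 := by linear_combination h - h'
  by_cases hx : x = 0
  · subst hx
    exact Or.inl ⟨rfl, by simpa [hA] using h⟩
  by_cases hy : y = 0
  · subst hy
    exact Or.inl ⟨by simpa [hB] using h, rfl⟩
  have hP : A - A' ≠ 0 := fun hP ↦ by
    have hQ : B - B' = 0 := by simpa [hP, hx] using hline
    exact hne.elim (· hP) (· hQ)
  have hQ : B - B' ≠ 0 := fun hQ ↦ by simp [hQ, hP, hy] at hline
  refine Or.inr ⟨?_, ?_⟩
  · rw [eq_div_iff (mul_ne_zero hd hQ)]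
    apply mul_left_cancel₀ hx
    linear_combination (-(A - A')) * h + (A + d * x) * hline
  · rw [eq_div_iff (mul_ne_zero hd hP)]
    apply mul_left_cancel₀ hy
    linear_combination (-(B - B')) * h + (B + d * y) * hline

theorem stmt8 (l1 l2 l l' a b : ℝ) (h12 : l1 ≠ l2)
    (hl : l ∉ ({l1, l2} : Set ℝ)) (hl' : l' ∉ ({l1, l2} : Set ℝ))
    (ha : 0 < a) (hb : 0 < b) (hne : (a, l) ≠ (b, l')) :
    ∃ p q : ℝ × ℝ,
      ({z : ℝ × ℝ | (l * a + l1 * z.1) * (a + z.2) = (l * a + l2 * z.2) * (a + z.1)} ∩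
       {z : ℝ × ℝ | (l' * b + l1 * z.1) * (b + z.2) = (l' * b + l2 * z.2) * (b + z.1)}) ⊆
        {p, q} := by
  simp only [Set.mem_insert_iff, Set.mem_singleton_iff, not_or] at hl
  have hd : l1 - l2 ≠ 0 := sub_ne_zero.2 h12
  have hA : a * (l - l2) ≠ 0 := mul_ne_zero ha.ne' (sub_ne_zero.2 hl.2)
  have hB : a * (l1 - l) ≠ 0 := mul_ne_zero ha.ne' (sub_ne_zero.2 (Ne.symm hl.1))
  have hcoeff : a * (l - l2) - b * (l' - l2) ≠ 0 ∨ a * (l1 - l) - b * (l1 - l') ≠ 0 := by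
    by_contra! hcon
    obtain ⟨hP, hQ⟩ := hcon
    have hab : a = b := mul_right_cancel₀ hd (by linear_combination hP + hQ)
    subst hab
    exact hne (Prod.ext rfl (mul_left_cancel₀ ha.ne' (by linear_combination hP)))
  let A := a * (l - l2)
  let B := a * (l1 - l)
  let P := A - b * (l' - l2)
  let Q := B - b * (l1 - l')
  refine ⟨(0, 0), ((B * P - A * Q) / ((l1 - l2) * Q), (A * Q - B * P) / ((l1 - l2) * P)), ?_⟩
  rintro ⟨x, y⟩ ⟨h, h'⟩
  simp only [Set.mem_ofPred_eq] at h h'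
  simpa only [Set.mem_insert_iff, Set.mem_singleton_iff, Prod.mk.injEq] using
    eq_zero_or_eq_of_mem_conics (x := x) (y := y) hd hA hB hcoeff
      (by linear_combination h) (by linear_combination h')
end

section
/- Let λ₁, λ₂, λ, λ' be real numbers with λ₁ ≠ λ₂, λ ∉ {λ₁, λ₂} and λ' ∉ {λ₁, λ₂}, and let a, b be positive reals with (a, λ) ≠ (b, λ'). Define the curves C₁ := {(x,y) ∈ ℝ² : (λa + λ₁x)(a + y) = (λa + λ₂y)(a + x)} and C₂ := {(x,y) ∈ ℝ² : (λ'b + λ₁x)(b + y) = (λ'b + λ₂y)(b + x)}. Then C₁ ∩ C₂ contains at most one point (x, y) with x > 0 and y > 0. Consequently, any two distinct points of the open positive quadrant lie simultaneously on at most one curve of this family. -/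
theorem stmt9 (l1 l2 l l' a b : ℝ) (h12 : l1 ≠ l2)
    (hl : l ∉ ({l1, l2} : Set ℝ)) (hl' : l' ∉ ({l1, l2} : Set ℝ))
    (ha : 0 < a) (hb : 0 < b) (hne : (a, l) ≠ (b, l')) :
    Set.Subsingleton
      ({z : ℝ × ℝ | (l * a + l1 * z.1) * (a + z.2) = (l * a + l2 * z.2) * (a + z.1)} ∩
       {z : ℝ × ℝ | (l' * b + l1 * z.1) * (b + z.2) = (l' * b + l2 * z.2) * (b + z.1)} ∩
       {z : ℝ × ℝ | 0 < z.1 ∧ 0 < z.2}) := by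
  rintro ⟨x, y⟩ ⟨⟨h1, h2⟩, hx, hy⟩ ⟨p, q⟩ ⟨⟨h3, h4⟩, hp, hq⟩
  simp only [Set.mem_ofPred_eq] at h1 h2 hx hy h3 h4 hp hq
  -- In the coordinates `1 / x`, `1 / y` both curves are lines; `D` is their determinant.
  obtain ⟨D, hD⟩ : ∃ D, D = a * (l - l2) * (b * (l' - l1)) - b * (l' - l2) * (a * (l - l1)) :=
    ⟨_, rfl⟩
  have cramer : ∀ s t : ℝ, 0 < s → 0 < t →
      (l * a + l1 * s) * (a + t) = (l * a + l2 * t) * (a + s) →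
      (l' * b + l1 * s) * (b + t) = (l' * b + l2 * t) * (b + s) →
      D = (l2 - l1) * (b * (l' - l1) - a * (l - l1)) * s ∧
        D = (l2 - l1) * (b * (l' - l2) - a * (l - l2)) * t := by
    intro s t hs ht e1 e2
    constructor
    · apply mul_right_cancel₀ ht.ne'
      rw [hD]
      linear_combination b * (l' - l1) * e1 - a * (l - l1) * e2
    · apply mul_right_cancel₀ hs.ne'
      rw [hD]
      linear_combination b * (l' - l2) * e1 - a * (l - l2) * e2
  obtain ⟨hDx, hDy⟩ := cramer x y hx hy h1 h2
  obtain ⟨hDp, hDq⟩ := cramer p q hp hq h3 h4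
  have hc : l2 - l1 ≠ 0 := sub_ne_zero.mpr h12.symm
  have hD0 : D ≠ 0 := by
    intro h0
    rw [h0] at hDx hDy
    have hB : b * (l' - l1) - a * (l - l1) = 0 := by simpa [hc, hx.ne'] using hDx.symm
    have hA : b * (l' - l2) - a * (l - l2) = 0 := by simpa [hc, hy.ne'] using hDy.symm
    have hab : a = b := mul_left_cancel₀ hc (by linear_combination hA - hB)
    subst hab
    have hll : l = l' := mul_left_cancel₀ ha.ne' (by linear_combination -hA)
    exact hne (by rw [hll])
  refine Prod.ext ?_ ?_
  · exact mul_left_cancel₀ (left_ne_zero_of_mul (hDx ▸ hD0)) (hDx.symm.trans hDp)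
  · exact mul_left_cancel₀ (left_ne_zero_of_mul (hDy ▸ hD0)) (hDy.symm.trans hDq)
end

section
/- Let λ₁, λ₂, λ₃, λ₄ be real numbers with λ₃ ≠ λ₄, λ₁ ∉ {λ₃, λ₄} and λ₂ ∉ {λ₃, λ₄}. For positive reals a, b define the curve l_{a,b} := {(x,y) ∈ ℝ² : (λ₃a + λ₁x)(b + y) = (λ₄b + λ₂y)(a + x)}. Then for any two pairs (a, b) ≠ (a', b') of positive reals, the intersection l_{a,b} ∩ l_{a',b'} contains at most 2 points. -/
/-- The real zeros of a nonzero polynomial of degree at most two are covered by two points. -/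
theorem exists_pair_of_quadratic_ne_zero (A B C : ℝ) (h : ¬ (B = 0 ∧ C = 0)) :
    ∃ u v : ℝ, ∀ x : ℝ, A * x ^ 2 + B * x + C = 0 → x = u ∨ x = v := by
  by_contra! hcon
  obtain ⟨x, hx, -, -⟩ := hcon 0 0
  obtain ⟨y, hy, hyx, -⟩ := hcon x x
  obtain ⟨z, hz, hzx, hzy⟩ := hcon x y
  have hxy : A * (y + x) + B = 0 :=
    mul_left_cancel₀ (sub_ne_zero.2 hyx) (by linear_combination hy - hx)
  have hxz : A * (z + x) + B = 0 :=
    mul_left_cancel₀ (sub_ne_zero.2 hzx) (by linear_combination hz - hx)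
  have hA : A = 0 :=
    mul_left_cancel₀ (sub_ne_zero.2 hzy) (by linear_combination hxz - hxy)
  subst hA
  have hB : B = 0 := by linarith
  subst hB
  exact h ⟨rfl, by linarith⟩


theorem stmt10 (l1 l2 l3 l4 : ℝ) (h34 : l3 ≠ l4)
    (h1 : l1 ∉ ({l3, l4} : Set ℝ)) (h2 : l2 ∉ ({l3, l4} : Set ℝ))
    (a b a' b' : ℝ) (ha : 0 < a) (hb : 0 < b) (ha' : 0 < a') (hb' : 0 < b')
    (hne : (a, b) ≠ (a', b')) :
    ∃ p q : ℝ × ℝ,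
      ({z : ℝ × ℝ | (l3 * a + l1 * z.1) * (b + z.2) = (l4 * b + l2 * z.2) * (a + z.1)} ∩
       {z : ℝ × ℝ | (l3 * a' + l1 * z.1) * (b' + z.2) = (l4 * b' + l2 * z.2) * (a' + z.1)}) ⊆
        {p, q} := by
  simp only [Set.mem_insert_iff, Set.mem_singleton_iff, not_or] at h1 h2
  have hp : l1 - l4 ≠ 0 := sub_ne_zero.2 h1.2
  have hq : l3 - l2 ≠ 0 := sub_ne_zero.2 (Ne.symm h2.1)
  have hr : l3 - l4 ≠ 0 := sub_ne_zero.2 h34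
  have hdet : (l1 - l3) * (l4 - l2) ≠ 0 :=
    mul_ne_zero (sub_ne_zero.2 h1.1) (sub_ne_zero.2 (Ne.symm h2.2))
  by_cases haa : a = a'
  · subst haa
    have hbb : b - b' ≠ 0 := sub_ne_zero.2 fun h => hne (by rw [h])
    refine ⟨(-((l3 - l4) * a) / (l1 - l4), 0), (-((l3 - l4) * a) / (l1 - l4), 0), ?_⟩
    rintro ⟨x, y⟩ ⟨hz, hz'⟩
    simp only [Set.mem_ofPred_eq] at hz hz'
    have hx : (l1 - l4) * x + (l3 - l4) * a = 0 :=
      mul_left_cancel₀ hbb (by linear_combination hz - hz')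
    have hy : y = 0 := by
      have : (a * ((l1 - l3) * (l4 - l2))) * y = 0 := by
        linear_combination (l1 - l4) * hz - ((l1 - l2) * y + (l1 - l4) * b) * hx
      exact (mul_eq_zero.1 this).resolve_left (mul_ne_zero ha.ne' hdet)
    left
    ext
    · simp only
      rw [eq_div_iff hp]
      linear_combination hx
    · exact hy
  · have hd : a - a' ≠ 0 := sub_ne_zero.2 haa
    have hqd : (l3 - l2) * (a - a') ≠ 0 := mul_ne_zero hq hd
    obtain ⟨u, v, huv⟩ := exists_pair_of_quadratic_ne_zero
      (-((l1 - l2) * ((l1 - l4) * (b - b'))))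
      (-((l1 - l2) * ((l3 - l4) * (a * b - a' * b')))
        + (l1 - l4) * b * ((l3 - l2) * (a - a')) - (l3 - l2) * a * ((l1 - l4) * (b - b')))
      ((l3 - l2) * (a * ((l3 - l4) * (a' * (b' - b)))))
      (by
        rintro ⟨hB, hC⟩
        have hbb : b' - b = 0 := by simpa [hq, hr, ha.ne', ha'.ne'] using hC
        obtain rfl : b' = b := sub_eq_zero.1 hbb
        have : (b' * (a - a')) * ((l1 - l3) * (l4 - l2)) = 0 := by linear_combination hB
        exact mul_ne_zero (mul_ne_zero hb.ne' hd) hdet this)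
    let f : ℝ → ℝ := fun x =>
      -((l1 - l4) * (b - b') * x + (l3 - l4) * (a * b - a' * b')) / ((l3 - l2) * (a - a'))
    refine ⟨(u, f u), (v, f v), ?_⟩
    rintro ⟨x, y⟩ ⟨hz, hz'⟩
    simp only [Set.mem_ofPred_eq] at hz hz'
    have hy : y = f x := by
      rw [eq_div_iff hqd]
      linear_combination hz - hz'
    have hx := huv x (by
      linear_combination ((l3 - l2) * (a - a')) * hz
        - ((l1 - l2) * x + (l3 - l2) * a) * (hz - hz'))
    rcases hx with rfl | rfl
    · exact Or.inl (by rw [hy])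
    · exact Or.inr (by rw [hy]; rfl)
end

section
/- Let λ₁, λ₂, λ₃, λ₄ be real numbers with λ₃ ≠ λ₄, λ₁ ∉ {λ₃, λ₄} and λ₂ ∉ {λ₃, λ₄}. For positive reals a, b define the curve l_{a,b} := {(x,y) ∈ ℝ² : (λ₃a + λ₁x)(b + y) = (λ₄b + λ₂y)(a + x)}. Then for any two distinct points p = (x₀, y₀) and q = (x₁, y₁), both with strictly positive coordinates, there are at most 2 pairs (a, b) of positive reals such that both p and q lie on l_{a,b}. -/
theorem exists_subset_pair_of_three {α : Type*} [Inhabited α] {S : Set α}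
    (h : ∀ u ∈ S, ∀ v ∈ S, ∀ w ∈ S, u = v ∨ u = w ∨ v = w) : ∃ s t : α, S ⊆ {s, t} := by
  rcases S.eq_empty_or_nonempty with rfl | ⟨u, hu⟩
  · exact ⟨default, default, Set.empty_subset _⟩
  · by_cases hv : ∃ v ∈ S, u ≠ v
    · obtain ⟨v, hv, huv⟩ := hv
      refine ⟨u, v, fun w hw => ?_⟩
      rcases h u hu v hv w hw with h | h | h
      · exact absurd h huv
      · exact Or.inl h.symm
      · exact Or.inr h.symm
    · push Not at hv
      exact ⟨u, u, fun w hw => Or.inl (hv w hw).symm⟩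

theorem quadratic_three_roots {K : Type*} [Field K] {α β γ a b c : K} (hα : α ≠ 0)
    (ha : α * a ^ 2 + β * a + γ = 0) (hb : α * b ^ 2 + β * b + γ = 0)
    (hc : α * c ^ 2 + β * c + γ = 0) : a = b ∨ a = c ∨ b = c := by
  have h : α * ((a - b) * ((a - c) * (b - c))) = 0 := by
    linear_combination (b - c) * ha - (a - c) * hb + (a - b) * hc
  simpa [hα, sub_eq_zero] using h

theorem stmt11 (l1 l2 l3 l4 : ℝ) (h34 : l3 ≠ l4)
    (h1 : l1 ∉ ({l3, l4} : Set ℝ)) (h2 : l2 ∉ ({l3, l4} : Set ℝ))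
    (p q : ℝ × ℝ) (hp : 0 < p.1 ∧ 0 < p.2) (hq : 0 < q.1 ∧ 0 < q.2) (hpq : p ≠ q) :
    ∃ s t : ℝ × ℝ,
      {ab : ℝ × ℝ | 0 < ab.1 ∧ 0 < ab.2 ∧
        (l3 * ab.1 + l1 * p.1) * (ab.2 + p.2) = (l4 * ab.2 + l2 * p.2) * (ab.1 + p.1) ∧
        (l3 * ab.1 + l1 * q.1) * (ab.2 + q.2) = (l4 * ab.2 + l2 * q.2) * (ab.1 + q.1)} ⊆
        {s, t} := by
  obtain ⟨x, y⟩ := p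
  obtain ⟨x', y'⟩ := q
  simp only [Set.mem_insert_iff, Set.mem_singleton_iff, not_or] at h1 h2
  obtain ⟨h13, h14⟩ := h1
  obtain ⟨h23, h24⟩ := h2
  dsimp only at hp hq ⊢
  have hA : l3 - l4 ≠ 0 := sub_ne_zero.2 h34
  have hB : l3 - l2 ≠ 0 := sub_ne_zero.2 (Ne.symm h23)
  have hC : l1 - l4 ≠ 0 := sub_ne_zero.2 h14
  have hdet : (l2 - l4) * (l3 - l1) ≠ 0 :=
    mul_ne_zero (sub_ne_zero.2 h24) (sub_ne_zero.2 (Ne.symm h13))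
  apply exists_subset_pair_of_three
  rintro ⟨a, b⟩ ⟨ha, hb, hu, hu'⟩ ⟨c, d⟩ ⟨-, -, hv, hv'⟩ ⟨e, f⟩ ⟨-, -, hw, hw'⟩
  dsimp only at ha hb hu hu' hv hv' hw hw'
  have line : ∀ a b : ℝ, (l3 * a + l1 * x) * (b + y) = (l4 * b + l2 * y) * (a + x) →
      (l3 * a + l1 * x') * (b + y') = (l4 * b + l2 * y') * (a + x') →
      (l3 - l2) * (y - y') * a + (l1 - l4) * (x - x') * b
        + (l1 - l2) * (x * y - x' * y') = 0 := by
    intro a b h h'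
    linear_combination h - h'
  by_cases hx : x = x'
  · subst hx
    have hy : y - y' ≠ 0 := sub_ne_zero.2 fun h => hpq (by rw [h])
    have hl : (l3 - l2) * a + (l1 - l2) * x = 0 := by
      apply mul_left_cancel₀ hy
      linear_combination line a b hu hu'
    have : b * x * ((l2 - l4) * (l3 - l1)) = 0 := by
      linear_combination (l3 - l2) * hu - ((l3 - l4) * b + (l3 - l2) * y) * hl
    exact absurd this (mul_ne_zero (mul_pos hb hp.1).ne' hdet)
  have hx : x - x' ≠ 0 := sub_ne_zero.2 hx
  by_cases hy : y = y'
  · subst hy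
    have hl : (l1 - l4) * b + (l1 - l2) * y = 0 := by
      apply mul_left_cancel₀ hx
      linear_combination line a b hu hu'
    have : a * y * ((l2 - l4) * (l3 - l1)) = 0 := by
      linear_combination (l1 - l4) * hu - ((l3 - l4) * a + (l1 - l4) * x) * hl
    exact absurd this (mul_ne_zero (mul_pos ha hp.2).ne' hdet)
  have hy : y - y' ≠ 0 := sub_ne_zero.2 hy
  have snd_eq : ∀ a b d : ℝ, (l3 - l2) * (y - y') * a + (l1 - l4) * (x - x') * b
        + (l1 - l2) * (x * y - x' * y') = 0 →
      (l3 - l2) * (y - y') * a + (l1 - l4) * (x - x') * d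
        + (l1 - l2) * (x * y - x' * y') = 0 → b = d := by
    intro a b d h h'
    apply mul_left_cancel₀ (mul_ne_zero hC hx)
    linear_combination h - h'
  have quad : ∀ a b : ℝ, (l3 * a + l1 * x) * (b + y) = (l4 * b + l2 * y) * (a + x) →
      (l3 * a + l1 * x') * (b + y') = (l4 * b + l2 * y') * (a + x') →
      (-((l3 - l4) * ((l3 - l2) * (y - y')))) * a ^ 2
        + ((l1 - l4) * (x - x') * ((l3 - l2) * y) - (l3 - l4) * ((l1 - l2) * (x * y - x' * y'))
          - (l1 - l4) * x * ((l3 - l2) * (y - y'))) * a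
        + ((l1 - l4) * (x - x') * ((l1 - l2) * (x * y))
          - (l1 - l4) * x * ((l1 - l2) * (x * y - x' * y'))) = 0 := by
    intro a b h h'
    linear_combination (l1 - l4) * (x - x') * h
      - ((l3 - l4) * a + (l1 - l4) * x) * line a b h h'
  have lu := line a b hu hu'
  have lv := line c d hv hv'
  have lw := line e f hw hw'
  rcases quadratic_three_roots (neg_ne_zero.2 (mul_ne_zero hA (mul_ne_zero hB hy)))
    (quad a b hu hu') (quad c d hv hv') (quad e f hw hw') with h | h | h <;> subst h
  · exact Or.inl (by rw [snd_eq _ _ _ lu lv])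
  · exact Or.inr (Or.inl (by rw [snd_eq _ _ _ lu lw]))
  · exact Or.inr (Or.inr (by rw [snd_eq _ _ _ lv lw]))
end
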